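/- Let N ≥ 2, let f ∈ L^1(S^N) with f(x) = 0 for x ∈ V ⊂ S^N, and let V₁ ⊂ V be a subdomain with γ(V₁, ∂V) > 0. If α = (N−1)/2, then there exists a constant c, not depending on f, such that for every μ > 0, σ{ x ∈ V₁ : S_*^α f(x) > μ } ≤ c ‖f‖_{L^1(S^N)} / μ. -/

import Mathlib

open MeasureTheory Metric Real Filter
open scoped BigOperators ENNReal NNReal RealInnerProductSpace Topology

noncomputable section

/-- The unit sphere `S^N` as a subtype of `ℝ^{N+1}` (with the Euclidean structure). -/
abbrev Sph (N : ℕ) : Type := Metric.sphere (0 : EuclideanSpace ℝ (Fin (N + 1))) 1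

/-- The surface measure `σ` on the sphere `S^N`. -/
def sphMeasure (N : ℕ) : Measure (Sph N) :=
  (volume : Measure (EuclideanSpace ℝ (Fin (N + 1)))).toSphere

/-- The spherical (geodesic) distance `γ(x,y) ∈ [0,π]` between two points of `S^N`. -/
def geoDist {N : ℕ} (x y : Sph N) : ℝ :=
  Real.arccos ⟪(x : EuclideanSpace ℝ (Fin (N + 1))), (y : EuclideanSpace ℝ (Fin (N + 1)))⟫

/-- The spherical ball `B(x,r) = {y : γ(x,y) ≤ r}`. -/
def sphBall {N : ℕ} (x : Sph N) (r : ℝ) : Set (Sph N) := {y | geoDist x y ≤ r}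

/-- The point of the sphere diametrically opposite to `x`. -/
def antipode {N : ℕ} (x : Sph N) : Sph N :=
  ⟨-(x : EuclideanSpace ℝ (Fin (N + 1))), by
    have hx := x.2
    simp only [mem_sphere_iff_norm, sub_zero, norm_neg] at hx ⊢
    exact hx⟩

/-- A spherical harmonic of degree `k` on `S^N`: the restriction to the sphere of a
homogeneous polynomial of degree `k` on `ℝ^{N+1}` annihilated by the Euclidean Laplacian
(equivalently, an eigenfunction of the Laplace–Beltrami operator `−Δ_s` with
eigenvalue `k(k+N−1)`). -/
def IsSphericalHarmonic (N k : ℕ) (g : Sph N → ℝ) : Prop :=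
  ∃ P : MvPolynomial (Fin (N + 1)) ℝ,
    P.IsHomogeneous k ∧
    (∑ i, MvPolynomial.pderiv i (MvPolynomial.pderiv i P)) = 0 ∧
    ∀ x : Sph N, g x = MvPolynomial.eval (fun i => (x : EuclideanSpace ℝ (Fin (N + 1))) i) P

/-- `Y k j`, `j < a k`, is for each `k` an orthonormal basis (w.r.t. `L²(S^N, σ)`)
of the space `ℵ_k` of spherical harmonics of degree `k`. -/
structure IsFourierLaplaceBasis (N : ℕ) (a : ℕ → ℕ) (Y : (k : ℕ) → Fin (a k) → Sph N → ℝ) :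
    Prop where
  harmonic : ∀ k j, IsSphericalHarmonic N k (Y k j)
  orthonormal : ∀ k, ∀ j j' : Fin (a k),
    ∫ x, Y k j x * Y k j' x ∂(sphMeasure N) = if j = j' then 1 else 0
  spanning : ∀ k (g : Sph N → ℝ), IsSphericalHarmonic N k g →
    g ∈ Submodule.span ℝ (Set.range (Y k))

/-- The Cesàro number `A_m^α = Γ(α+m+1)/(Γ(α+1) m!)`. -/
def cesaroA (α : ℝ) (m : ℕ) : ℝ :=
  Real.Gamma (α + m + 1) / (Real.Gamma (α + 1) * (Nat.factorial m))

/-- The Fourier–Laplace coefficient `f_{k,j} = ∫_{S^N} f(y) Y_j^k(y) dσ(y)`. -/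
def flCoeff {N : ℕ} {a : ℕ → ℕ} (Y : (k : ℕ) → Fin (a k) → Sph N → ℝ) (f : Sph N → ℝ)
    (k : ℕ) (j : Fin (a k)) : ℝ :=
  ∫ y, f y * Y k j y ∂(sphMeasure N)

/-- The Cesàro mean of order `α` of the Fourier–Laplace series of `f`:
`S_n^α f(x) = (1/A_n^α) Σ_{k=0}^n A_{n−k}^α Σ_{j=1}^{a_k} f_{k,j} Y_j^k(x)`. -/
def cesaroMean {N : ℕ} {a : ℕ → ℕ} (Y : (k : ℕ) → Fin (a k) → Sph N → ℝ) (α : ℝ)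
    (f : Sph N → ℝ) (n : ℕ) (x : Sph N) : ℝ :=
  (cesaroA α n)⁻¹ *
    ∑ k ∈ Finset.range (n + 1), cesaroA α (n - k) * ∑ j, flCoeff Y f k j * Y k j x

/-- The maximal operator `S_*^α f(x) = sup_{n ≥ 1} |S_n^α f(x)|` (with values in `ℝ≥0∞`). -/
def cesaroMaximal {N : ℕ} {a : ℕ → ℕ} (Y : (k : ℕ) → Fin (a k) → Sph N → ℝ) (α : ℝ)
    (f : Sph N → ℝ) (x : Sph N) : ℝ≥0∞ :=
  ⨆ (n : ℕ) (_ : 1 ≤ n), ENNReal.ofReal |cesaroMean Y α f n x|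

/-- The Hardy–Littlewood maximal function
`f*(x) = sup_{r>0} (1/σ(B(x,r))) ∫_{B(x,r)} |f| dσ` (with values in `ℝ≥0∞`). -/
def hlMaximal {N : ℕ} (f : Sph N → ℝ) (x : Sph N) : ℝ≥0∞ :=
  ⨆ (r : ℝ) (_ : 0 < r),
    (sphMeasure N (sphBall x r))⁻¹ * ∫⁻ y in sphBall x r, ENNReal.ofReal |f y| ∂(sphMeasure N)

/-- The Cesàro means of order `α` of the spectral function:
`Θ^α(x,y,n) = (1/A_n^α) Σ_{k=0}^n A_{n−k}^α Σ_{j=1}^{a_k} Y_j^k(x) Y_j^k(y)`. -/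
def cesaroKernel {N : ℕ} {a : ℕ → ℕ} (Y : (k : ℕ) → Fin (a k) → Sph N → ℝ) (α : ℝ)
    (n : ℕ) (x y : Sph N) : ℝ :=
  (cesaroA α n)⁻¹ *
    ∑ k ∈ Finset.range (n + 1), cesaroA α (n - k) * ∑ j, Y k j x * Y k j y

/-- The Gegenbauer sequence `C_k^l(L, R)` (homogenized by `R`) in an `ℝ`-algebra, defined by its
three-term recurrence. -/
def gegenbauerSeq {A : Type*} [CommRing A] [Algebra ℝ A] (l : ℝ) (L R : A) : ℕ → A
  | 0 => 1
  | 1 => 2 * algebraMap ℝ A l * L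
  | k + 2 => algebraMap ℝ A ((k + 2 : ℝ)⁻¹) *
      (2 * (k + 1 + algebraMap ℝ A l) * L * gegenbauerSeq l L R (k + 1) -
        (k + 2 * algebraMap ℝ A l) * R * gegenbauerSeq l L R k)

section GegenbauerAlgebra

variable {A : Type*} [CommRing A] [Algebra ℝ A]

theorem gegenbauerSeq_rec (l : ℝ) (L R : A) (k : ℕ) :
    ((k : A) + 2) * gegenbauerSeq l L R (k + 2) =
      2 * (k + 1 + algebraMap ℝ A l) * L * gegenbauerSeq l L R (k + 1) -
        (k + 2 * algebraMap ℝ A l) * R * gegenbauerSeq l L R k := by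
  have h : ((k : A) + 2) * algebraMap ℝ A ((k + 2 : ℝ)⁻¹) = 1 := by
    have h2 : ((k : A) + 2) = algebraMap ℝ A (k + 2 : ℝ) := by simp [map_ofNat]
    rw [h2, ← map_mul, mul_inv_cancel₀ (by positivity), map_one]
  rw [gegenbauerSeq, ← mul_assoc, h, one_mul]

theorem map_gegenbauerSeq {B : Type*} [CommRing B] [Algebra ℝ B] (φ : A →ₐ[ℝ] B) (l : ℝ)
    (L R : A) : ∀ k, φ (gegenbauerSeq l L R k) = gegenbauerSeq l (φ L) (φ R) k
  | 0 => by simp [gegenbauerSeq]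
  | 1 => by simp [gegenbauerSeq, map_ofNat]
  | k + 2 => by
    have h1 := map_gegenbauerSeq φ l L R (k + 1)
    have h0 := map_gegenbauerSeq φ l L R k
    simp only [gegenbauerSeq, map_mul, map_sub, map_add, map_natCast, AlgHom.commutes, h0, h1,
      map_one, map_ofNat]

theorem derivation_gegenbauerSeq [IsDomain A] [CharZero A] (D : Derivation ℝ A A) (l : ℝ)
    (L R : A) (hL : D L = 1) (hR : D R = 2 * L) :
    ∀ k : ℕ, D (gegenbauerSeq l L R (k + 1)) =
      (k + 2 * algebraMap ℝ A l) * gegenbauerSeq l L R k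
  | 0 => by
    have e2 : D 2 = 0 := by exact_mod_cast D.map_natCast 2
    simp [gegenbauerSeq, hL, e2]
  | 1 => by
    have h2 : (2 : A) ≠ 0 := two_ne_zero
    have h := congrArg D (gegenbauerSeq_rec l L R 0)
    have e2 : D 2 = 0 := by exact_mod_cast D.map_natCast 2
    simp only [gegenbauerSeq, Derivation.leibniz, map_add, map_sub,
      D.map_algebraMap, e2, hL, hR, smul_eq_mul, Derivation.map_one_eq_zero, mul_zero, add_zero,
      zero_add, Nat.cast_zero] at h ⊢
    refine mul_left_cancel₀ h2 ?_
    push_cast at h ⊢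
    linear_combination h
  | k + 2 => by
    have ih1 := derivation_gegenbauerSeq D l L R hL hR (k + 1)
    have ih0 := derivation_gegenbauerSeq D l L R hL hR k
    have h3 : ((k : A) + 3) ≠ 0 := by exact_mod_cast (Nat.succ_ne_zero (k + 2))
    have h := congrArg D (gegenbauerSeq_rec l L R (k + 1))
    have hr := gegenbauerSeq_rec l L R k
    have e2 : D 2 = 0 := by exact_mod_cast D.map_natCast 2
    push_cast at h ih1 ⊢
    simp only [Derivation.leibniz, map_add, map_sub, D.map_natCast, D.map_algebraMap, e2, hL, hR,
      smul_eq_mul, Derivation.map_one_eq_zero, mul_zero, add_zero, ih1, ih0] at h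
    refine mul_left_cancel₀ h3 ?_
    linear_combination h - (k + 1 + 2 * algebraMap ℝ A l) * hr

end GegenbauerAlgebra

section SolidHarmonics

open MvPolynomial

variable {σ : Type*} [Fintype σ]

/-- The Euclidean Laplacian of a polynomial. -/
def polyLaplacian (P : MvPolynomial σ ℝ) : MvPolynomial σ ℝ := ∑ i, pderiv i (pderiv i P)

/-- The directional derivative of polynomials in the direction `x`. -/
def dirDeriv (x : σ → ℝ) : Derivation ℝ (MvPolynomial σ ℝ) (MvPolynomial σ ℝ) :=
  ∑ i, (C (x i) : MvPolynomial σ ℝ) • pderiv i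

/-- The linear form `y ↦ ⟨x, y⟩`. -/
def linForm (x : σ → ℝ) : MvPolynomial σ ℝ := ∑ i, C (x i) * X i

/-- The polynomial `|y|²`. -/
def normSqPoly (σ : Type*) [Fintype σ] : MvPolynomial σ ℝ := ∑ i, X i ^ 2

theorem dirDeriv_apply (x : σ → ℝ) (P : MvPolynomial σ ℝ) :
    dirDeriv x P = ∑ i, C (x i) * pderiv i P := by
  have h : dirDeriv x P = Derivation.coeFnAddMonoidHom (dirDeriv x) P := rfl
  rw [h, dirDeriv, map_sum, Finset.sum_apply]
  rfl

theorem pderiv_linForm (x : σ → ℝ) (i : σ) : pderiv i (linForm x) = C (x i) := by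
  classical
  simp [linForm, pderiv_X, Pi.single_apply]

theorem pderiv_normSqPoly (i : σ) : pderiv i (normSqPoly σ) = 2 * X i := by
  classical
  simp [normSqPoly, pderiv_X, Pi.single_apply, Derivation.leibniz_pow]

theorem dirDeriv_linForm (x : σ → ℝ) (hx : ∑ i, x i ^ 2 = 1) : dirDeriv x (linForm x) = 1 := by
  simp only [dirDeriv_apply, pderiv_linForm, ← pow_two, ← map_pow]
  rw [← map_sum, hx, C_1]

theorem dirDeriv_normSqPoly (x : σ → ℝ) : dirDeriv x (normSqPoly σ) = 2 * linForm x := by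
  simp only [dirDeriv_apply, pderiv_normSqPoly, linForm, Finset.mul_sum]
  exact Finset.sum_congr rfl fun i _ => by ring

theorem polyLaplacian_sub (P Q : MvPolynomial σ ℝ) :
    polyLaplacian (P - Q) = polyLaplacian P - polyLaplacian Q := by
  simp [polyLaplacian, Finset.sum_sub_distrib]

theorem polyLaplacian_C_mul (c : ℝ) (P : MvPolynomial σ ℝ) :
    polyLaplacian (C c * P) = C c * polyLaplacian P := by
  simp [polyLaplacian, Finset.mul_sum]

theorem polyLaplacian_linForm_mul (x : σ → ℝ) (P : MvPolynomial σ ℝ) :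
    polyLaplacian (linForm x * P) = linForm x * polyLaplacian P + 2 * dirDeriv x P := by
  simp only [polyLaplacian, dirDeriv_apply, Finset.mul_sum, ← Finset.sum_add_distrib]
  refine Finset.sum_congr rfl fun i _ => ?_
  simp only [Derivation.leibniz, pderiv_linForm, map_add, pderiv_C, smul_eq_mul]
  ring

theorem polyLaplacian_normSqPoly_mul (k : ℕ) (P : MvPolynomial σ ℝ) (hP : P.IsHomogeneous k) :
    polyLaplacian (normSqPoly σ * P) = normSqPoly σ * polyLaplacian P +
      (4 * k + 2 * Fintype.card σ) * P := by
  have h : ∀ i, pderiv i (pderiv i (normSqPoly σ * P)) =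
      normSqPoly σ * pderiv i (pderiv i P) + 4 * (X i * pderiv i P) + 2 * P := by
    intro i
    have e2 : pderiv i (2 : MvPolynomial σ ℝ) = 0 := by exact_mod_cast (pderiv i).map_natCast 2
    simp only [Derivation.leibniz, pderiv_normSqPoly, map_add, smul_eq_mul, e2, pderiv_X_self]
    ring
  have hE := hP.sum_X_mul_pderiv
  simp only [polyLaplacian, h, Finset.sum_add_distrib, ← Finset.mul_sum, hE]
  simp
  ring

theorem isHomogeneous_linForm (x : σ → ℝ) : (linForm x).IsHomogeneous 1 :=
  IsHomogeneous.sum _ _ _ fun i _ => by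
    simpa using (isHomogeneous_C σ (x i)).mul (isHomogeneous_X ℝ i)

theorem isHomogeneous_normSqPoly : (normSqPoly σ).IsHomogeneous 2 :=
  IsHomogeneous.sum _ _ _ fun i _ => by
    simpa using (isHomogeneous_X ℝ i).pow 2

theorem isHomogeneous_gegenbauerSeq (l : ℝ) (x : σ → ℝ) :
    ∀ k, (gegenbauerSeq l (linForm x) (normSqPoly σ) k).IsHomogeneous k
  | 0 => isHomogeneous_one σ ℝ
  | 1 => by
    simpa [gegenbauerSeq, map_ofNat] using (isHomogeneous_C σ (2 * l)).mul (isHomogeneous_linForm x)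
  | k + 2 => by
    have h1 := isHomogeneous_gegenbauerSeq l x (k + 1)
    have h0 := isHomogeneous_gegenbauerSeq l x k
    have e1 : (2 * ((k : MvPolynomial σ ℝ) + 1 + algebraMap ℝ _ l)) =
        C (2 * (k + 1 + l)) := by simp [map_ofNat]
    have e0 : ((k : MvPolynomial σ ℝ) + 2 * algebraMap ℝ _ l) = C (k + 2 * l) := by simp [map_ofNat]
    rw [gegenbauerSeq, e1, e0, mul_assoc, mul_assoc]
    have a1 := (isHomogeneous_C σ (2 * (k + 1 + l))).mul ((isHomogeneous_linForm x).mul h1)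
    have a0 := (isHomogeneous_C σ (k + 2 * l)).mul ((isHomogeneous_normSqPoly (σ := σ)).mul h0)
    rw [show 0 + (1 + (k + 1)) = k + 2 by ring] at a1
    rw [show 0 + (2 + k) = k + 2 by ring] at a0
    simpa using (isHomogeneous_C σ ((k + 2 : ℝ)⁻¹)).mul (a1.sub a0)

theorem polyLaplacian_gegenbauerSeq (l : ℝ) (hl : 2 * l + 2 = Fintype.card σ) (x : σ → ℝ)
    (hx : ∑ i, x i ^ 2 = 1) :
    ∀ k, polyLaplacian (gegenbauerSeq l (linForm x) (normSqPoly σ) k) = 0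
  | 0 => by simp [polyLaplacian, gegenbauerSeq]
  | 1 => by
    have h : gegenbauerSeq l (linForm x) (normSqPoly σ) 1 = C (2 * l) * linForm x := by
      simp [gegenbauerSeq, map_ofNat]
    rw [h, polyLaplacian_C_mul]
    simp [polyLaplacian, pderiv_linForm]
  | k + 2 => by
    have h1 := polyLaplacian_gegenbauerSeq l hl x hx (k + 1)
    have h0 := polyLaplacian_gegenbauerSeq l hl x hx k
    have hD := derivation_gegenbauerSeq (dirDeriv x) l _ _ (dirDeriv_linForm x hx)
      (dirDeriv_normSqPoly x) k
    have e1 : (2 * ((k : MvPolynomial σ ℝ) + 1 + algebraMap ℝ _ l)) =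
        C (2 * (k + 1 + l)) := by simp [map_ofNat]
    have e0 : ((k : MvPolynomial σ ℝ) + 2 * algebraMap ℝ _ l) = C (k + 2 * l) := by simp [map_ofNat]
    have hc : (Fintype.card σ : MvPolynomial σ ℝ) = C (2 * l + 2) := by rw [hl]; simp
    rw [gegenbauerSeq, e1, e0, mul_assoc, mul_assoc, algebraMap_eq, polyLaplacian_C_mul,
      polyLaplacian_sub, polyLaplacian_C_mul, polyLaplacian_C_mul, polyLaplacian_linForm_mul,
      polyLaplacian_normSqPoly_mul k _ (isHomogeneous_gegenbauerSeq l x k), h1, h0, hD, hc]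
    simp only [algebraMap_eq, map_add, map_mul, map_natCast, map_ofNat, map_one]
    ring

end SolidHarmonics

section GeneratingFunction

/-- The formal power series `(1 - a X)^{-p}`. -/
def negPowSeries (p a : ℂ) : PowerSeries ℂ := PowerSeries.mk fun n => Ring.multichoose p n * a ^ n

theorem succ_mul_multichoose_succ (p : ℂ) (n : ℕ) :
    ((n : ℂ) + 1) * Ring.multichoose p (n + 1) = (p + n) * Ring.multichoose p n := by
  have h1 := Ring.factorial_nsmul_multichoose_eq_ascPochhammer p (n + 1)
  have h0 := Ring.factorial_nsmul_multichoose_eq_ascPochhammer p n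
  rw [Polynomial.ascPochhammer_smeval_eq_eval] at h1 h0
  rw [ascPochhammer_succ_eval, ← h0] at h1
  simp only [nsmul_eq_mul, Nat.factorial_succ] at h1
  have hn : (n.factorial : ℂ) ≠ 0 := by exact_mod_cast n.factorial_ne_zero
  refine mul_left_cancel₀ hn ?_
  push_cast at h1
  linear_combination h1

theorem cesaroA_eq_multichoose {l : ℝ} (hl : 0 < l) (n : ℕ) :
    (cesaroA l n : ℂ) = Ring.multichoose (l + 1 : ℂ) n := by
  induction n with
  | zero =>
    have : Real.Gamma (l + 1) ≠ 0 := (Real.Gamma_pos_of_pos (by linarith)).ne'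
    simp [cesaroA, this]
  | succ n ih =>
    have h := succ_mul_multichoose_succ (l + 1 : ℂ) n
    rw [← ih] at h
    have hn : ((n : ℂ) + 1) ≠ 0 := by exact_mod_cast n.succ_ne_zero
    refine mul_left_cancel₀ hn ?_
    rw [h]
    have hG : Real.Gamma (l + 1) ≠ 0 := (Real.Gamma_pos_of_pos (by linarith)).ne'
    have h2 : ((n : ℝ) + 1) * cesaroA l (n + 1) = (l + 1 + n) * cesaroA l n := by
      have h3 : Real.Gamma (l + (n + 1 : ℕ) + 1) = (l + n + 1) * Real.Gamma (l + n + 1) := by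
        rw [← Real.Gamma_add_one (by positivity)]
        push_cast
        ring_nf
      have hf : (n.factorial : ℝ) ≠ 0 := by exact_mod_cast n.factorial_ne_zero
      rw [cesaroA, cesaroA, h3, Nat.factorial_succ]
      push_cast
      field_simp
      ring
    exact_mod_cast h2

theorem one_sub_mul_negPowSeries (p a : ℂ) :
    (1 - PowerSeries.C a * PowerSeries.X) * negPowSeries (p + 1) a = negPowSeries p a := by
  ext n
  cases n with
  | zero => simp [negPowSeries, sub_mul, mul_assoc]
  | succ n =>
    simp only [negPowSeries, sub_mul, one_mul, mul_assoc, map_sub, PowerSeries.coeff_C_mul,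
      PowerSeries.coeff_succ_X_mul, PowerSeries.coeff_mk, Ring.multichoose_succ_succ]
    ring

theorem one_sub_mul_derivative_negPowSeries (p a : ℂ) :
    (1 - PowerSeries.C a * PowerSeries.X) * PowerSeries.derivative ℂ (negPowSeries p a) =
      PowerSeries.C (p * a) * negPowSeries p a := by
  ext n
  cases n with
  | zero =>
    simp only [negPowSeries, sub_mul, one_mul, mul_assoc, map_sub, PowerSeries.coeff_C_mul,
      PowerSeries.coeff_zero_X_mul, PowerSeries.coeff_mk, PowerSeries.coeff_derivative]
    simp
  | succ n =>
    have h := succ_mul_multichoose_succ p (n + 1)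
    simp only [negPowSeries, sub_mul, one_mul, mul_assoc, map_sub, PowerSeries.coeff_C_mul,
      PowerSeries.coeff_succ_X_mul, PowerSeries.coeff_mk, PowerSeries.coeff_derivative]
    push_cast at h ⊢
    linear_combination a ^ (n + 2) * h

variable (l : ℝ) (t : ℝ) {a b : ℂ}

theorem derivative_negPowSeries_mul (p : ℂ) (a b : ℂ) :
    (1 - PowerSeries.C a * PowerSeries.X) * (1 - PowerSeries.C b * PowerSeries.X) *
      PowerSeries.derivative ℂ (negPowSeries p a * negPowSeries p b) =
      PowerSeries.C p * (PowerSeries.C (a + b) - PowerSeries.C (2 * (a * b)) * PowerSeries.X) *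
        (negPowSeries p a * negPowSeries p b) := by
  have ha := one_sub_mul_derivative_negPowSeries p a
  have hb := one_sub_mul_derivative_negPowSeries p b
  rw [Derivation.leibniz]
  simp only [smul_eq_mul, map_mul, map_add, map_ofNat] at ha hb ⊢
  linear_combination (1 - PowerSeries.C b * PowerSeries.X) * negPowSeries p b * ha +
    (1 - PowerSeries.C a * PowerSeries.X) * negPowSeries p a * hb

theorem coeff_negPowSeries_mul (hab : a * b = 1) (hs : a + b = 2 * t) :
    ∀ k, PowerSeries.coeff k (negPowSeries l a * negPowSeries l b) =
      ((gegenbauerSeq l t (1 : ℝ) k : ℝ) : ℂ)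
  | 0 => by simp [negPowSeries, gegenbauerSeq]
  | 1 => by
    simp [negPowSeries, gegenbauerSeq, PowerSeries.coeff_mul, Finset.Nat.antidiagonal_succ]
    linear_combination (l : ℂ) * hs
  | k + 2 => by
    have h1 := coeff_negPowSeries_mul hab hs (k + 1)
    have h0 := coeff_negPowSeries_mul hab hs k
    have hr := congrArg (fun r : ℝ => (r : ℂ)) (gegenbauerSeq_rec l t (1 : ℝ) k)
    have hD := derivative_negPowSeries_mul l a b
    have hpoly : (1 - PowerSeries.C a * PowerSeries.X) * (1 - PowerSeries.C b * PowerSeries.X) =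
        (1 : PowerSeries ℂ) - PowerSeries.C (2 * t : ℂ) * PowerSeries.X +
          PowerSeries.X * PowerSeries.X := by
      rw [← hs, map_add]
      have : PowerSeries.C a * PowerSeries.C b = (1 : PowerSeries ℂ) := by
        rw [← map_mul, hab, map_one]
      linear_combination PowerSeries.X ^ 2 * this
    set H := negPowSeries l a * negPowSeries l b
    rw [hpoly, hab, hs] at hD
    have hc := congrArg (PowerSeries.coeff (k + 1)) hD
    have hx : PowerSeries.coeff (k + 1)
        (PowerSeries.X * (PowerSeries.X * PowerSeries.derivative ℂ H)) =
        k * PowerSeries.coeff k H := by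
      rw [PowerSeries.coeff_succ_X_mul]
      cases k with
      | zero => simp
      | succ k =>
        rw [PowerSeries.coeff_succ_X_mul, PowerSeries.coeff_derivative]
        push_cast
        ring
    simp only [sub_mul, add_mul, one_mul, mul_assoc, map_sub, map_add, PowerSeries.coeff_C_mul,
      PowerSeries.coeff_succ_X_mul, hx, PowerSeries.coeff_derivative, mul_sub] at hc
    simp only [h1, h0] at hc
    push_cast at hc hr
    simp only [Algebra.algebraMap_self, RingHom.id_apply] at hr
    have hk : ((k : ℂ) + 2) ≠ 0 := by exact_mod_cast (k + 1).succ_ne_zero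
    refine mul_left_cancel₀ hk ?_
    linear_combination hc - hr

/-- The generating series of the (unnormalized) Cesàro means of order `l` of the zonal kernels. -/
def cesaroSeries (l : ℝ) (a b : ℂ) : PowerSeries ℂ :=
  (1 + PowerSeries.X) * (negPowSeries l 1 *
    (negPowSeries (l + 1 : ℂ) a * negPowSeries (l + 1 : ℂ) b))

theorem coeff_cesaroSeries (hl : 0 < l) (hab : a * b = 1) (hs : a + b = 2 * t) (n : ℕ) :
    (l : ℂ) * PowerSeries.coeff n (cesaroSeries l a b) =
      ((∑ k ∈ Finset.range (n + 1), cesaroA l (n - k) * ((k + l) * gegenbauerSeq l t (1 : ℝ) k) :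
        ℝ) : ℂ) := by
  have hD := derivative_negPowSeries_mul l a b
  have e1 := one_sub_mul_negPowSeries l 1
  have ea := one_sub_mul_negPowSeries l a
  have eb := one_sub_mul_negPowSeries l b
  set H := negPowSeries l a * negPowSeries l b with hH
  have hpoly : (1 - PowerSeries.C a * PowerSeries.X) * (1 - PowerSeries.C b * PowerSeries.X) ≠
      (0 : PowerSeries ℂ) := by
    intro h
    have := congrArg (PowerSeries.coeff 0) h
    simp at this
  have hQ : PowerSeries.X * PowerSeries.derivative ℂ H + PowerSeries.C (l : ℂ) * H =
      PowerSeries.C (l : ℂ) * ((1 - PowerSeries.X ^ 2) *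
        (negPowSeries (l + 1 : ℂ) a * negPowSeries (l + 1 : ℂ) b)) := by
    refine mul_left_cancel₀ hpoly ?_
    have hC : PowerSeries.C a * PowerSeries.C b = (1 : PowerSeries ℂ) := by
      rw [← map_mul, hab, map_one]
    rw [hab] at hD
    simp only [map_add, map_ofNat, mul_one] at hD
    have hHB : (1 - PowerSeries.C a * PowerSeries.X) * (1 - PowerSeries.C b * PowerSeries.X) *
        (negPowSeries (l + 1 : ℂ) a * negPowSeries (l + 1 : ℂ) b) = H := by
      rw [hH, ← ea, ← eb]; ring
    linear_combination PowerSeries.X * hD +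
      PowerSeries.C (l : ℂ) * (PowerSeries.X ^ 2 - 1) * hHB +
      PowerSeries.C (l : ℂ) * H * PowerSeries.X ^ 2 * hC
  have hΦ : PowerSeries.C (l : ℂ) * cesaroSeries l a b =
      (PowerSeries.X * PowerSeries.derivative ℂ H + PowerSeries.C (l : ℂ) * H) *
        negPowSeries (l + 1 : ℂ) 1 := by
    rw [hQ, cesaroSeries, ← e1, map_one]
    ring
  have hcoef : ∀ k, PowerSeries.coeff k (PowerSeries.X * PowerSeries.derivative ℂ H +
      PowerSeries.C (l : ℂ) * H) = (k + l) * ((gegenbauerSeq l t (1 : ℝ) k : ℝ) : ℂ) := by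
    intro k
    rw [← coeff_negPowSeries_mul l t hab hs k]
    cases k with
    | zero => simp [hH]
    | succ k =>
      simp only [map_add, PowerSeries.coeff_succ_X_mul, PowerSeries.coeff_derivative,
        PowerSeries.coeff_C_mul, ← hH]
      push_cast
      ring
  rw [← PowerSeries.coeff_C_mul, hΦ, PowerSeries.coeff_mul,
    Finset.Nat.sum_antidiagonal_eq_sum_range_succ_mk]
  push_cast
  refine Finset.sum_congr rfl fun k _ => ?_
  rw [hcoef, negPowSeries, PowerSeries.coeff_mk, one_pow, mul_one, cesaroA_eq_multichoose hl]
  ring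

end GeneratingFunction

section DiskSums

/-- The power series `f` converges absolutely in the open unit disk, with sum `F`. -/
def HasDiskSum (f : PowerSeries ℂ) (F : ℂ → ℂ) : Prop :=
  ∀ z : ℂ, ‖z‖ < 1 → Summable (fun n => ‖PowerSeries.coeff n f * z ^ n‖) ∧
    ∑' n, PowerSeries.coeff n f * z ^ n = F z

theorem HasDiskSum.mul {f g : PowerSeries ℂ} {F G : ℂ → ℂ} (hf : HasDiskSum f F)
    (hg : HasDiskSum g G) : HasDiskSum (f * g) fun z => F z * G z := by
  intro z hz
  obtain ⟨f1, f2⟩ := hf z hz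
  obtain ⟨g1, g2⟩ := hg z hz
  have key : ∀ n, PowerSeries.coeff n (f * g) * z ^ n =
      ∑ kl ∈ Finset.HasAntidiagonal.antidiagonal n, (PowerSeries.coeff kl.1 f * z ^ kl.1) *
        (PowerSeries.coeff kl.2 g * z ^ kl.2) := by
    intro n
    rw [PowerSeries.coeff_mul, Finset.sum_mul]
    refine Finset.sum_congr rfl fun kl hkl => ?_
    rw [← Finset.HasAntidiagonal.mem_antidiagonal.1 hkl, pow_add]
    ring
  refine ⟨(summable_norm_sum_mul_antidiagonal_of_summable_norm f1 g1).congr fun n => ?_, ?_⟩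
  · rw [key n]
  · rw [tsum_congr key, ← tsum_mul_tsum_eq_tsum_sum_antidiagonal_of_summable_norm f1 g1, f2, g2]

theorem hasDiskSum_one_add_X : HasDiskSum (1 + PowerSeries.X) fun z => 1 + z := by
  intro z _
  have h : ∀ n ∉ Finset.range 2, PowerSeries.coeff n (1 + PowerSeries.X : PowerSeries ℂ) * z ^ n
      = 0 := by
    intro n hn
    rw [Finset.mem_range, not_lt] at hn
    simp [PowerSeries.coeff_X, PowerSeries.coeff_one, show n ≠ 0 by omega, show n ≠ 1 by omega]
  refine ⟨summable_of_ne_finset_zero (s := Finset.range 2) fun n hn => by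
    rw [h n hn, norm_zero], ?_⟩
  rw [tsum_eq_sum h]
  simp [Finset.sum_range_succ, PowerSeries.coeff_X, PowerSeries.coeff_one]

theorem hasDiskSum_negPowSeries (p : ℂ) {a : ℂ} (ha : ‖a‖ = 1) :
    HasDiskSum (negPowSeries p a) fun z => 1 / (1 - a * z) ^ p := by
  intro z hz
  have h := Complex.one_div_one_sub_cpow_hasFPowerSeriesOnBall_zero p
  have hz' : a * z ∈ Metric.eball (0 : ℂ) 1 := by
    have h1 : ‖a * z‖ < 1 := by rwa [norm_mul, ha, one_mul]
    rw [Metric.mem_eball, edist_zero_right, enorm_eq_nnnorm]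
    exact_mod_cast h1
  have hs := h.hasSum hz'
  have hn := FormalMultilinearSeries.summable_norm_apply _ (Metric.eball_subset_eball h.r_le hz')
  have key : ∀ n, (FormalMultilinearSeries.ofScalars ℂ fun n : ℕ => Ring.choose (p + n - 1) n) n
      (fun _ => a * z) = PowerSeries.coeff n (negPowSeries p a) * z ^ n := by
    intro n
    have hm : Ring.choose (p + n - 1) n = Ring.multichoose p n := by
      rw [Ring.choose]; congr 1; ring
    rw [FormalMultilinearSeries.ofScalars_apply_eq, hm, negPowSeries, PowerSeries.coeff_mk,
      smul_eq_mul, mul_pow]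
    ring
  simp only [key, zero_add] at hs hn
  exact ⟨hn, hs.tsum_eq⟩

theorem HasDiskSum.hasFPowerSeriesOnBall {f : PowerSeries ℂ} {F : ℂ → ℂ} (hf : HasDiskSum f F) :
    HasFPowerSeriesOnBall F
      (FormalMultilinearSeries.ofScalars ℂ fun n => PowerSeries.coeff n f) 0 1 := by
  refine ⟨?_, one_pos, ?_⟩
  · refine ENNReal.le_of_forall_nnreal_lt fun r hr => ?_
    have hr' : (r : ℝ) < 1 := by exact_mod_cast hr
    refine FormalMultilinearSeries.le_radius_of_summable_norm _ ?_
    have := (hf (r : ℝ) (by simpa using hr')).1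
    refine this.congr fun n => ?_
    rw [FormalMultilinearSeries.ofScalars_norm]
    simp
  · intro y hy
    have hy' : ‖y‖ < 1 := by
      rw [Metric.mem_eball, edist_zero_right, enorm_eq_nnnorm] at hy
      exact_mod_cast hy
    obtain ⟨h1, h2⟩ := hf y hy'
    rw [zero_add, ← h2]
    simpa only [FormalMultilinearSeries.ofScalars_apply_eq, smul_eq_mul] using h1.of_norm.hasSum

theorem HasDiskSum.continuousOn {f : PowerSeries ℂ} {F : ℂ → ℂ} (hf : HasDiskSum f F) :
    ContinuousOn F (ball 0 1) := by
  have := hf.hasFPowerSeriesOnBall.continuousOn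
  rwa [← ENNReal.coe_one, Metric.eball_coe] at this

theorem HasDiskSum.norm_coeff_le {f : PowerSeries ℂ} {F : ℂ → ℂ} (hf : HasDiskSum f F)
    {r : ℝ} (hr : 0 < r) (hr1 : r < 1) (n : ℕ) :
    ‖PowerSeries.coeff n f‖ ≤
      ((2 * π)⁻¹ * ∫ θ in (0 : ℝ)..2 * π, ‖F (circleMap 0 r θ)‖) * r⁻¹ ^ n := by
  lift r to ℝ≥0 using hr.le
  have h1 := hf.hasFPowerSeriesOnBall
  have hd : DiffContOnCl ℂ F (ball 0 r) := by
    apply DifferentiableOn.diffContOnCl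
    refine h1.differentiableOn.mono ?_
    rw [← ENNReal.coe_one, Metric.eball_coe]
    exact closure_ball_subset_closedBall.trans (closedBall_subset_ball (by simpa using hr1))
  have h2 := hd.hasFPowerSeriesOnBall (by exact_mod_cast hr)
  have h3 := h1.hasFPowerSeriesAt.eq_formalMultilinearSeries h2.hasFPowerSeriesAt
  have h4 := norm_cauchyPowerSeries_le F 0 r n
  rw [← h3, FormalMultilinearSeries.ofScalars_norm] at h4
  simpa using h4

end DiskSums

section CircleIntegrals

theorem le_norm_one_sub_circleMap {r θ : ℝ} (hr : 1 / 2 ≤ r) (hθ : |θ| ≤ π) :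
    ((1 - r) + |θ|) / 4 ≤ ‖1 - circleMap 0 r θ‖ := by
  have hc := Real.cos_le_one_sub_mul_cos_sq hθ
  have hn : ‖1 - circleMap 0 r θ‖ ^ 2 = (1 - r) ^ 2 + 2 * r * (1 - Real.cos θ) := by
    rw [Complex.sq_norm, Complex.normSq_apply]
    simp [circleMap, Complex.exp_ofReal_mul_I_re, Complex.exp_ofReal_mul_I_im]
    linear_combination r ^ 2 * Real.sin_sq_add_cos_sq θ
  refine le_of_sq_le_sq ?_ (norm_nonneg _)
  rw [hn]
  have hpi : (2 : ℝ) / 10 ≤ 2 / π ^ 2 := by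
    apply div_le_div_of_nonneg_left <;> nlinarith [Real.pi_pos, Real.pi_lt_d2]
  have h1 : 2 / 10 * θ ^ 2 ≤ 1 - Real.cos θ := by nlinarith [sq_nonneg θ]
  have h2 : 1 - Real.cos θ ≤ 2 * r * (1 - Real.cos θ) := by nlinarith [sq_nonneg θ]
  nlinarith [sq_nonneg ((1 - r) - |θ|), sq_abs θ, sq_nonneg (1 - r), sq_nonneg θ]

theorem one_sub_mul_circleMap_ne_zero {a : ℂ} (ha : ‖a‖ = 1) {r : ℝ} (hr : 0 ≤ r) (hr1 : r < 1)
    (θ : ℝ) : 1 - a * circleMap 0 r θ ≠ 0 := by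
  intro h
  have h1 : ‖a * circleMap 0 r θ‖ = 1 := by rw [← sub_eq_zero.1 h, norm_one]
  rw [norm_mul, ha, one_mul, norm_circleMap_zero, abs_of_nonneg hr] at h1
  exact hr1.ne h1

theorem continuous_norm_one_sub_mul_circleMap_rpow {a : ℂ} (ha : ‖a‖ = 1) {r : ℝ} (hr : 0 ≤ r)
    (hr1 : r < 1) (p : ℝ) : Continuous fun θ => ‖1 - a * circleMap 0 r θ‖ ^ p := by
  refine Continuous.rpow_const (by fun_prop) fun θ => Or.inl ?_
  exact norm_ne_zero_iff.2 (one_sub_mul_circleMap_ne_zero ha hr hr1 θ)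

theorem integral_add_rpow_neg_le {h l : ℝ} (hh : 0 < h) (hl : 0 < l) :
    ∫ θ in (0 : ℝ)..π, (h + θ) ^ (-(l + 1)) ≤ h ^ (-l) / l := by
  rw [intervalIntegral.integral_comp_add_left fun x => x ^ (-(l + 1)), integral_rpow]
  · have h1 : -(l + 1) + 1 = -l := by ring
    rw [h1, div_neg, ← neg_div]
    gcongr
    have := Real.rpow_nonneg (by positivity : 0 ≤ h + π) (-l)
    simp
    linarith
  · right
    refine ⟨by linarith, ?_⟩
    rw [Set.uIcc_of_le (by linarith [Real.pi_pos])]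
    simp
    intro h; linarith

theorem integral_norm_one_sub_circleMap_rpow_le {r l : ℝ} (hr : 1 / 2 ≤ r) (hr1 : r < 1)
    (hl : 0 < l) :
    ∫ θ in (0 : ℝ)..2 * π, ‖1 - circleMap 0 r θ‖ ^ (-(l + 1)) ≤
      2 * 4 ^ (l + 1) / l * (1 - r) ^ (-l) := by
  set g : ℝ → ℝ := fun θ => ‖1 - circleMap 0 r θ‖ ^ (-(l + 1)) with hg
  have hgc : Continuous g := by
    have := continuous_norm_one_sub_mul_circleMap_rpow (a := 1) (by simp) (by linarith) hr1
      (-(l + 1))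
    simpa only [one_mul] using this
  have hper : Function.Periodic g (2 * π) := by
    intro θ
    simp only [hg, periodic_circleMap 0 r θ]
  have hshift := hper.intervalIntegral_add_eq 0 (-π)
  have e1 : -π + 2 * π = π := by ring
  rw [zero_add, e1] at hshift
  rw [hshift]
  set k : ℝ → ℝ := fun θ => 4 ^ (l + 1) * ((1 - r) + θ) ^ (-(l + 1)) with hk
  have hle : ∀ θ, |θ| ≤ π → g θ ≤ k |θ| := by
    intro θ hθ
    have h1 := le_norm_one_sub_circleMap hr hθ
    have hpos : 0 < (1 - r) + |θ| := by linarith [abs_nonneg θ]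
    calc g θ ≤ (((1 - r) + |θ|) / 4) ^ (-(l + 1)) :=
          Real.rpow_le_rpow_of_nonpos (by positivity) h1 (by linarith)
      _ = k |θ| := by
          rw [hk, Real.div_rpow hpos.le (by norm_num), Real.rpow_neg (by norm_num : (0:ℝ) ≤ 4)]
          field_simp
  have hkc : ContinuousOn k (Set.Ici 0) := by
    refine ContinuousOn.mul continuousOn_const (ContinuousOn.rpow_const (by fun_prop) ?_)
    intro θ hθ
    left
    have : (0 : ℝ) ≤ θ := hθ
    linarith
  have hki : IntervalIntegrable k volume 0 π := by
    refine (hkc.mono ?_).intervalIntegrable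
    rw [Set.uIcc_of_le Real.pi_pos.le]
    exact Set.Icc_subset_Ici_self
  have hkI : ∫ θ in (0 : ℝ)..π, k θ ≤ 4 ^ (l + 1) * ((1 - r) ^ (-l) / l) := by
    rw [hk, intervalIntegral.integral_const_mul]
    gcongr
    exact integral_add_rpow_neg_le (by linarith) hl
  have hright : ∫ θ in (0 : ℝ)..π, g θ ≤ ∫ θ in (0 : ℝ)..π, k θ := by
    refine intervalIntegral.integral_mono_on Real.pi_pos.le (hgc.intervalIntegrable _ _) hki ?_
    intro θ hθ
    have := hle θ (by rw [abs_of_nonneg hθ.1]; exact hθ.2)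
    rwa [abs_of_nonneg hθ.1] at this
  have hleft : ∫ θ in (-π)..0, g θ ≤ ∫ θ in (0 : ℝ)..π, k θ := by
    have := intervalIntegral.integral_comp_neg (a := 0) (b := π) g
    rw [neg_zero] at this
    rw [← this]
    refine intervalIntegral.integral_mono_on Real.pi_pos.le
      ((hgc.comp continuous_neg).intervalIntegrable _ _) hki ?_
    intro θ hθ
    have := hle (-θ) (by rw [abs_neg, abs_of_nonneg hθ.1]; exact hθ.2)
    rwa [abs_neg, abs_of_nonneg hθ.1] at this
  rw [← intervalIntegral.integral_add_adjacent_intervals (hgc.intervalIntegrable (-π) 0)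
    (hgc.intervalIntegrable 0 π)]
  calc _ ≤ 4 ^ (l + 1) * ((1 - r) ^ (-l) / l) + 4 ^ (l + 1) * ((1 - r) ^ (-l) / l) := by
        linarith
    _ = _ := by ring

theorem integral_norm_one_sub_mul_circleMap_rpow (r p : ℝ) {a : ℂ} (ha : ‖a‖ = 1) :
    ∫ θ in (0 : ℝ)..2 * π, ‖1 - a * circleMap 0 r θ‖ ^ p =
      ∫ θ in (0 : ℝ)..2 * π, ‖1 - circleMap 0 r θ‖ ^ p := by
  set g : ℝ → ℝ := fun θ => ‖1 - circleMap 0 r θ‖ ^ p with hg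
  have hper : Function.Periodic g (2 * π) := by
    intro θ
    simp only [hg, periodic_circleMap 0 r θ]
  have h1 : ∀ θ : ℝ, ‖1 - a * circleMap 0 r θ‖ ^ p = g (θ + a.arg) := by
    intro θ
    have h2 : a = Complex.exp (a.arg * Complex.I) := by
      have := Complex.norm_mul_exp_arg_mul_I a
      rw [ha] at this
      simpa using this.symm
    have h3 : a * circleMap 0 r θ = circleMap 0 r (θ + a.arg) := by
      conv_lhs => rw [h2]
      simp only [circleMap, zero_add, Complex.ofReal_add, add_mul, Complex.exp_add]
      ring
    rw [hg, h3]
  simp only [h1]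
  rw [intervalIntegral.integral_comp_add_right g, zero_add, add_comm,
    hper.intervalIntegral_add_eq a.arg 0, zero_add]

end CircleIntegrals

section KernelBound

theorem rpow_neg_mul_le_of_two_mul_le_add {u v s p : ℝ} (hu : 0 < u) (hv : 0 < v) (hs : 0 < s)
    (hp : 0 ≤ p) (h : 2 * s ≤ u + v) :
    u ^ (-p) * v ^ (-p) ≤ s ^ (-p) * (u ^ (-p) + v ^ (-p)) := by
  have hu' := Real.rpow_nonneg hu.le (-p)
  have hv' := Real.rpow_nonneg hv.le (-p)
  have hs' := Real.rpow_nonneg hs.le (-p)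
  rcases le_total s u with h1 | h1
  · have := Real.rpow_le_rpow_of_nonpos hs h1 (neg_nonpos.2 hp)
    nlinarith
  · have := Real.rpow_le_rpow_of_nonpos hs (by linarith : s ≤ v) (neg_nonpos.2 hp)
    nlinarith

theorem three_singularities_le {u v w s τ l : ℝ} (hu : 0 < u) (hv : 0 < v) (hw : 0 < w)
    (hs : 0 < s) (hτ : 0 < τ) (hl : 0 < l) (huv : 2 * s ≤ u + v) (huw : 2 * τ ≤ u + w)
    (hvw : 2 * τ ≤ v + w) (hw2 : w ≤ 2) :
    w ^ (-l) * (u ^ (-(l + 1)) * v ^ (-(l + 1))) ≤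
      (τ ^ (-l) + 4 * τ ^ (-(l + 1))) * s ^ (-(l + 1)) *
        (u ^ (-(l + 1)) + v ^ (-(l + 1)) + w ^ (-(l + 1))) := by
  have h := rpow_neg_mul_le_of_two_mul_le_add hu hv hs (by linarith : 0 ≤ l + 1) huv
  set p := l + 1
  have hu' := Real.rpow_nonneg hu.le (-p)
  have hv' := Real.rpow_nonneg hv.le (-p)
  have hw' := Real.rpow_nonneg hw.le (-p)
  have hs' := Real.rpow_nonneg hs.le (-p)
  have hτ' := Real.rpow_nonneg hτ.le (-p)
  have hτl := Real.rpow_nonneg hτ.le (-l)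
  rcases le_total τ w with h1 | h1
  · calc w ^ (-l) * (u ^ (-p) * v ^ (-p)) ≤ τ ^ (-l) * (s ^ (-p) * (u ^ (-p) + v ^ (-p))) := by
          have := Real.rpow_le_rpow_of_nonpos hτ h1 (by linarith : -l ≤ 0)
          exact mul_le_mul this h (by positivity) hτl
      _ = (τ ^ (-l)) * s ^ (-p) * (u ^ (-p) + v ^ (-p)) := by ring
      _ ≤ _ := mul_le_mul (mul_le_mul_of_nonneg_right (by linarith) hs') (by linarith)
          (by positivity) (by positivity)
  · have hwl : w ^ (-l) ≤ 2 * w ^ (-p) := by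
      have : w ^ (-l) = w * w ^ (-p) := by
        rw [mul_comm, ← Real.rpow_add_one hw.ne']; congr 1; simp only [p]; ring
      rw [this]; gcongr
    have hu1 : u ^ (-p) ≤ τ ^ (-p) :=
      Real.rpow_le_rpow_of_nonpos hτ (by linarith) (by simp only [p]; linarith)
    have hv1 : v ^ (-p) ≤ τ ^ (-p) :=
      Real.rpow_le_rpow_of_nonpos hτ (by linarith) (by simp only [p]; linarith)
    calc w ^ (-l) * (u ^ (-p) * v ^ (-p))
        ≤ (2 * w ^ (-p)) * (s ^ (-p) * (τ ^ (-p) + τ ^ (-p))) := by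
          refine mul_le_mul hwl (h.trans ?_) (by positivity) (by positivity)
          gcongr
      _ = (4 * τ ^ (-p)) * s ^ (-p) * w ^ (-p) := by ring
      _ ≤ _ := mul_le_mul (mul_le_mul_of_nonneg_right (by linarith) hs') (by linarith)
          (by positivity) (by positivity)

theorem hasDiskSum_cesaroSeries (l : ℝ) {a b : ℂ} (ha : ‖a‖ = 1) (hb : ‖b‖ = 1) :
    HasDiskSum (cesaroSeries l a b) fun z => (1 + z) * (1 / (1 - 1 * z) ^ (l : ℂ) *
      (1 / (1 - a * z) ^ (l + 1 : ℂ) * (1 / (1 - b * z) ^ (l + 1 : ℂ)))) :=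
  hasDiskSum_one_add_X.mul ((hasDiskSum_negPowSeries _ norm_one).mul
    ((hasDiskSum_negPowSeries _ ha).mul (hasDiskSum_negPowSeries _ hb)))

theorem norm_coeff_cesaroSeries_le {l s τ : ℝ} (hl : 0 < l) (hs : 0 < s) (hτ : 0 < τ) {a b : ℂ}
    (ha : ‖a‖ = 1) (hb : ‖b‖ = 1) (hab : 2 * s ≤ ‖a - b‖) (ha1 : 2 * τ ≤ ‖1 - a‖)
    (hb1 : 2 * τ ≤ ‖1 - b‖) {n : ℕ} (hn : 1 ≤ n) :
    ‖PowerSeries.coeff n (cesaroSeries l a b)‖ ≤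
      ((2 * π)⁻¹ * (2 * (τ ^ (-l) + 4 * τ ^ (-(l + 1))) * (3 * (2 * 4 ^ (l + 1) / l))) *
        Real.exp 1) * s ^ (-(l + 1)) * (n + 1) ^ l := by
  have hn0 : (1 : ℝ) ≤ n := by exact_mod_cast hn
  set r : ℝ := n / (n + 1) with hr
  have hr1 : r < 1 := by rw [hr, div_lt_one (by positivity)]; linarith
  have hr2 : 1 / 2 ≤ r := by rw [hr, div_le_div_iff₀ (by norm_num) (by positivity)]; linarith
  have hr0 : 0 < r := by linarith
  have h1r : 1 - r = (n + 1 : ℝ)⁻¹ := by rw [hr]; field_simp; ring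
  have hF := hasDiskSum_cesaroSeries l ha hb
  have hcoef := hF.norm_coeff_le hr0 hr1 n
  set F : ℂ → ℂ := fun z => (1 + z) * (1 / (1 - 1 * z) ^ (l : ℂ) *
      (1 / (1 - a * z) ^ (l + 1 : ℂ) * (1 / (1 - b * z) ^ (l + 1 : ℂ)))) with hFdef
  have hpow : r⁻¹ ^ n ≤ Real.exp 1 := by
    have h2 : r⁻¹ = 1 + (n : ℝ)⁻¹ := by rw [hr]; field_simp
    have h3 : r⁻¹ ≤ Real.exp ((n : ℝ)⁻¹) := by
      rw [h2]; linarith [Real.add_one_le_exp ((n : ℝ)⁻¹)]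
    calc r⁻¹ ^ n ≤ Real.exp ((n : ℝ)⁻¹) ^ n := by gcongr
      _ = Real.exp 1 := by
        rw [← Real.exp_nat_mul, mul_inv_cancel₀ (by positivity)]
  set K := τ ^ (-l) + 4 * τ ^ (-(l + 1)) with hK
  have hK0 : 0 ≤ K := by positivity
  set U : ℂ → ℝ → ℝ := fun c θ => ‖1 - c * circleMap 0 r θ‖ ^ (-(l + 1)) with hU
  have hUc : ∀ c : ℂ, ‖c‖ = 1 → Continuous (U c) := fun c hc =>
    continuous_norm_one_sub_mul_circleMap_rpow hc hr0.le hr1 _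
  have hUI : ∀ c : ℂ, ‖c‖ = 1 → ∫ θ in (0 : ℝ)..2 * π, U c θ ≤
      2 * 4 ^ (l + 1) / l * (n + 1) ^ l := by
    intro c hc
    rw [hU, integral_norm_one_sub_mul_circleMap_rpow r _ hc]
    refine (integral_norm_one_sub_circleMap_rpow_le hr2 hr1 hl).trans_eq ?_
    rw [h1r, Real.inv_rpow (by positivity), Real.rpow_neg (by positivity), inv_inv]
  have hpt : ∀ θ, ‖F (circleMap 0 r θ)‖ ≤
      2 * K * s ^ (-(l + 1)) * (U a θ + U b θ + U 1 θ) := by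
    intro θ
    set z := circleMap 0 r θ with hz
    have hznorm : ‖z‖ = r := by rw [hz, norm_circleMap_zero, abs_of_pos hr0]
    have hcp : ∀ c q : ℂ, ∀ x : ℝ, q = x → ‖1 / (1 - c * z) ^ q‖ = ‖1 - c * z‖ ^ (-x) := by
      rintro c q x rfl
      rw [norm_div, norm_one, Complex.norm_cpow_real, Real.rpow_neg (norm_nonneg _), one_div]
    have hpos : ∀ c : ℂ, ‖c‖ = 1 → 0 < ‖1 - c * z‖ := fun c hc =>
      norm_pos_iff.2 (one_sub_mul_circleMap_ne_zero hc hr0.le hr1 θ)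
    have h1z : ‖1 + z‖ ≤ 2 := by
      refine (norm_add_le _ _).trans ?_
      rw [norm_one, hznorm]; linarith
    have h1z' : ‖1 - 1 * z‖ ≤ 2 := by
      refine (norm_sub_le _ _).trans ?_
      rw [one_mul, norm_one, hznorm]; linarith
    have hsum : ∀ c d : ℂ, ‖c‖ = 1 → ‖d‖ = 1 → ‖c - d‖ ≤ ‖1 - c * z‖ + ‖1 - d * z‖ := by
      intro c d hc hd
      have : c - d = c * (1 - d * z) - d * (1 - c * z) := by ring
      rw [this]
      refine (norm_sub_le _ _).trans ?_
      rw [norm_mul, norm_mul, hc, hd]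
      linarith
    have hmain := three_singularities_le (hpos a ha) (hpos b hb) (hpos 1 norm_one) hs hτ hl
      (hab.trans (hsum a b ha hb))
      ((by rwa [norm_sub_rev] : 2 * τ ≤ ‖a - 1‖).trans (hsum a 1 ha norm_one))
      ((by rwa [norm_sub_rev] : 2 * τ ≤ ‖b - 1‖).trans (hsum b 1 hb norm_one)) h1z'
    rw [hFdef]
    simp only [norm_mul]
    rw [hcp 1 l l rfl, hcp a _ (l + 1) (by push_cast; rfl), hcp b _ (l + 1) (by push_cast; rfl)]
    calc _ ≤ 2 * (K * s ^ (-(l + 1)) * (U a θ + U b θ + U 1 θ)) := by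
          refine mul_le_mul h1z hmain (by positivity) (by norm_num)
      _ = _ := by ring
  have hFc : Continuous fun θ => ‖F (circleMap 0 r θ)‖ := by
    refine (hF.continuousOn.comp_continuous (continuous_circleMap 0 r) fun θ => ?_).norm
    rw [mem_ball_zero_iff, norm_circleMap_zero, abs_of_pos hr0]
    exact hr1
  have hintF : ∫ θ in (0 : ℝ)..2 * π, ‖F (circleMap 0 r θ)‖ ≤
      2 * K * s ^ (-(l + 1)) * (3 * (2 * 4 ^ (l + 1) / l * (n + 1) ^ l)) := by
    have ia := (hUc a ha).intervalIntegrable (μ := volume) 0 (2 * π)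
    have ib := (hUc b hb).intervalIntegrable (μ := volume) 0 (2 * π)
    have i1 := (hUc 1 norm_one).intervalIntegrable (μ := volume) 0 (2 * π)
    calc ∫ θ in (0 : ℝ)..2 * π, ‖F (circleMap 0 r θ)‖
        ≤ ∫ θ in (0 : ℝ)..2 * π, 2 * K * s ^ (-(l + 1)) * (U a θ + U b θ + U 1 θ) :=
          intervalIntegral.integral_mono_on (by positivity) (hFc.intervalIntegrable _ _)
            (((ia.add ib).add i1).const_mul _) fun θ _ => hpt θ
      _ = 2 * K * s ^ (-(l + 1)) * ((∫ θ in (0 : ℝ)..2 * π, U a θ) +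
            (∫ θ in (0 : ℝ)..2 * π, U b θ) + ∫ θ in (0 : ℝ)..2 * π, U 1 θ) := by
          rw [intervalIntegral.integral_const_mul, intervalIntegral.integral_add (ia.add ib) i1,
            intervalIntegral.integral_add ia ib]
      _ ≤ _ := by
          have := hUI a ha
          have := hUI b hb
          have := hUI 1 norm_one
          gcongr
          linarith
  refine hcoef.trans ?_
  calc _ ≤ ((2 * π)⁻¹ * (2 * K * s ^ (-(l + 1)) * (3 * (2 * 4 ^ (l + 1) / l * (n + 1) ^ l)))) *
        Real.exp 1 := by gcongr
    _ = _ := by ring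

/-- Away from `t = 1`, the unnormalized critical Cesàro means of the zonal kernels are
controlled by the singularity at `t = -1`. -/
theorem exists_cesaroSum_le {l τ : ℝ} (hl : 0 < l) (hτ : 0 < τ) :
    ∃ C : ℝ, 0 ≤ C ∧ ∀ t : ℝ, -1 < t → t ≤ 1 - 2 * τ → ∀ n : ℕ, 1 ≤ n →
      |∑ k ∈ Finset.range (n + 1), cesaroA l (n - k) * ((k + l) * gegenbauerSeq l t (1 : ℝ) k)| ≤
        C * √(1 - t ^ 2) ^ (-(l + 1)) * (n + 1) ^ l := by
  refine ⟨l * ((2 * π)⁻¹ * (2 * (τ ^ (-l) + 4 * τ ^ (-(l + 1))) * (3 * (2 * 4 ^ (l + 1) / l))) *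
        Real.exp 1), by positivity, fun t ht ht1 n hn => ?_⟩
  have ht2 : 0 < 1 - t ^ 2 := by nlinarith
  set s := √(1 - t ^ 2) with hs
  have hs0 : 0 < s := Real.sqrt_pos.2 ht2
  have hss : s ^ 2 = 1 - t ^ 2 := Real.sq_sqrt ht2.le
  set a : ℂ := ⟨t, s⟩ with ha
  set b : ℂ := ⟨t, -s⟩ with hb
  have hna : ‖a‖ = 1 := by
    rw [← sq_eq_sq₀ (norm_nonneg _) zero_le_one, Complex.sq_norm, Complex.normSq_apply, ha]
    nlinarith
  have hnb : ‖b‖ = 1 := by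
    rw [← sq_eq_sq₀ (norm_nonneg _) zero_le_one, Complex.sq_norm, Complex.normSq_apply, hb]
    nlinarith
  have h := norm_coeff_cesaroSeries_le hl hs0 hτ hna hnb
    ((by simp [ha, hb]; linarith [le_abs_self (s + s)] : 2 * s ≤ |(a - b).im|).trans
      (Complex.abs_im_le_norm _))
    ((by simp [ha]; linarith [le_abs_self (1 - t)] : 2 * τ ≤ |(1 - a).re|).trans
      (Complex.abs_re_le_norm _))
    ((by simp [hb]; linarith [le_abs_self (1 - t)] : 2 * τ ≤ |(1 - b).re|).trans
      (Complex.abs_re_le_norm _)) hn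
  have hc := coeff_cesaroSeries l t hl (a := a) (b := b)
    (by apply Complex.ext <;> simp [ha, hb] <;> nlinarith)
    (by apply Complex.ext <;> simp [ha, hb]; ring) n
  rw [← Real.norm_eq_abs, ← Complex.norm_real, ← hc, norm_mul, Complex.norm_real,
    Real.norm_of_nonneg hl.le, mul_assoc, mul_assoc]
  rw [mul_assoc] at h
  exact mul_le_mul_of_nonneg_left h hl.le

theorem exists_le_cesaroA {l : ℝ} (hl : 0 < l) :
    ∃ c : ℝ, 0 < c ∧ ∀ n : ℕ, 1 ≤ n → c * (n + 1) ^ l ≤ cesaroA l n := by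
  obtain ⟨M, hM⟩ := (Real.GammaSeq_tendsto_Gamma l).bddAbove_range
  have hprod : ∀ n : ℕ, Real.Gamma (l + n + 1) =
      Real.Gamma l * ∏ j ∈ Finset.range (n + 1), (l + j) := by
    intro n
    induction n with
    | zero => simp [Real.Gamma_add_one hl.ne', mul_comm]
    | succ n ih =>
      have h := Real.Gamma_add_one (s := l + n + 1) (by positivity)
      rw [Finset.prod_range_succ, ← mul_assoc, ← ih, mul_comm]
      push_cast
      rw [← add_assoc, h]
  have hG := Real.Gamma_pos_of_pos hl
  have hG1 := Real.Gamma_pos_of_pos (by linarith : 0 < l + 1)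
  set M' := max M 1
  refine ⟨2 ^ (-l) * Real.Gamma l / (M' * Real.Gamma (l + 1)), by positivity, fun n hn => ?_⟩
  have h1 : Real.GammaSeq l n ≤ M' := (hM ⟨n, rfl⟩).trans (le_max_left _ _)
  have hP : 0 < ∏ j ∈ Finset.range (n + 1), (l + j) := Finset.prod_pos fun j _ => by positivity
  rw [Real.GammaSeq, div_le_iff₀ hP] at h1
  have h2 : (2 : ℝ) ^ (-l) * (n + 1) ^ l ≤ n ^ l := by
    rw [Real.rpow_neg (by norm_num), inv_mul_le_iff₀ (by positivity),
      ← Real.mul_rpow (by norm_num) (by positivity)]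
    have : (1 : ℝ) ≤ n := by exact_mod_cast hn
    gcongr
    linarith
  have hf : (0 : ℝ) < n.factorial := by positivity
  rw [cesaroA, hprod, le_div_iff₀ (by positivity)]
  calc _ = (2 ^ (-l) * (n + 1) ^ l) * n.factorial * Real.Gamma l / M' := by field_simp
    _ ≤ (n ^ l) * n.factorial * Real.Gamma l / M' := by gcongr
    _ ≤ _ := by
      rw [div_le_iff₀ (by positivity)]
      nlinarith

end KernelBound

section GaussianFunctional

open MvPolynomial

/-- The moments of the (unnormalized) one-dimensional Gaussian. -/
def gaussMoment (k : ℕ) : ℝ := ∫ x : ℝ, x ^ k * Real.exp (-(1 / 2) * x ^ 2)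

theorem integrable_pow_mul_gauss (k : ℕ) :
    Integrable fun x : ℝ => x ^ k * Real.exp (-(1 / 2) * x ^ 2) := by
  have h := integrable_rpow_mul_exp_neg_mul_sq (b := 1 / 2) (by norm_num) (s := k)
    (by linarith [(Nat.cast_nonneg k : (0 : ℝ) ≤ k)])
  simpa only [Real.rpow_natCast] using h

theorem gaussMoment_succ (k : ℕ) : gaussMoment (k + 1) = k * gaussMoment (k - 1) := by
  have hd : ∀ x : ℝ, HasDerivAt (fun x : ℝ => x ^ k * Real.exp (-(1 / 2) * x ^ 2))
      (k * (x ^ (k - 1) * Real.exp (-(1 / 2) * x ^ 2)) -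
        x ^ (k + 1) * Real.exp (-(1 / 2) * x ^ 2)) x := by
    intro x
    have h1 : HasDerivAt (fun x : ℝ => -(1 / 2) * x ^ 2) (-x) x := by
      refine ((hasDerivAt_pow 2 x).const_mul (-(1 / 2) : ℝ)).congr_deriv ?_
      push_cast
      ring
    refine ((hasDerivAt_pow k x).mul h1.exp).congr_deriv ?_
    ring
  have i1 := (integrable_pow_mul_gauss (k - 1)).const_mul (k : ℝ)
  have i2 := integrable_pow_mul_gauss (k + 1)
  have h := integral_eq_zero_of_hasDerivAt_of_integrable hd (i1.sub i2)
    (integrable_pow_mul_gauss k)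
  rw [integral_sub i1 i2, integral_const_mul] at h
  rw [gaussMoment, gaussMoment]
  linarith

variable {σ : Type*} [Fintype σ]

/-- Integration of polynomials against the (unnormalized) Gaussian, as a linear functional. -/
def gaussExpect (σ : Type*) [Fintype σ] : MvPolynomial σ ℝ →ₗ[ℝ] ℝ :=
  (basisMonomials σ ℝ).constr ℝ fun s => ∏ i, gaussMoment (s i)

theorem gaussExpect_monomial (s : σ →₀ ℕ) (a : ℝ) :
    gaussExpect σ (monomial s a) = a * ∏ i, gaussMoment (s i) := by
  have h : monomial s a = a • (basisMonomials σ ℝ s) := by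
    rw [coe_basisMonomials, smul_monomial, smul_eq_mul, mul_one]
  rw [h, map_smul, gaussExpect, Module.Basis.constr_basis, smul_eq_mul]

theorem gaussExpect_X_mul (i : σ) (P : MvPolynomial σ ℝ) :
    gaussExpect σ (X i * P) = gaussExpect σ (pderiv i P) := by
  classical
  induction P using MvPolynomial.induction_on' with
  | monomial s a =>
    rw [pderiv_monomial, X, monomial_mul, one_mul, gaussExpect_monomial, gaussExpect_monomial,
      ← Finset.mul_prod_erase _ (fun j => gaussMoment ((Finsupp.single i 1 + s : σ →₀ ℕ) j))
        (Finset.mem_univ i),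
      ← Finset.mul_prod_erase _ (fun j => gaussMoment ((s - Finsupp.single i 1 : σ →₀ ℕ) j))
        (Finset.mem_univ i)]
    have h1 : ∏ j ∈ Finset.univ.erase i, gaussMoment ((Finsupp.single i 1 + s : σ →₀ ℕ) j) =
        ∏ j ∈ Finset.univ.erase i, gaussMoment ((s - Finsupp.single i 1 : σ →₀ ℕ) j) := by
      refine Finset.prod_congr rfl fun j hj => ?_
      have : i ≠ j := fun h => (Finset.mem_erase.1 hj).1 h.symm
      simp [this]
    rw [h1]
    simp only [Finsupp.add_apply, Finsupp.tsub_apply, Finsupp.single_eq_same]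
    rw [add_comm 1, gaussMoment_succ]
    ring
  | add p q hp hq => rw [mul_add, map_add, map_add, map_add, hp, hq]

theorem gaussExpect_normSqPoly_mul {k : ℕ} {P : MvPolynomial σ ℝ} (hP : P.IsHomogeneous k) :
    gaussExpect σ (normSqPoly σ * P) = (k + Fintype.card σ) * gaussExpect σ P := by
  have h : normSqPoly σ * P = ∑ i, X i * (X i * P) := by
    rw [normSqPoly, Finset.sum_mul]
    exact Finset.sum_congr rfl fun i _ => by ring
  have h2 : ∀ i : σ, pderiv i (X i * P) = X i * pderiv i P + P := by
    intro i
    rw [Derivation.leibniz, pderiv_X_self, smul_eq_mul, smul_eq_mul, mul_one]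
  rw [h, map_sum]
  simp only [gaussExpect_X_mul, h2]
  rw [← map_sum, Finset.sum_add_distrib, hP.sum_X_mul_pderiv]
  rw [Finset.sum_const, Finset.card_univ, map_add, map_nsmul, map_nsmul, nsmul_eq_mul,
    nsmul_eq_mul, add_mul]

theorem natCast_mul_gaussExpect_mul {k : ℕ} {P : MvPolynomial σ ℝ} (hP : P.IsHomogeneous k)
    (hΔ : polyLaplacian P = 0) (Q : MvPolynomial σ ℝ) :
    k * gaussExpect σ (P * Q) = gaussExpect σ (∑ i, pderiv i P * pderiv i Q) := by
  have h1 : (k : ℝ) * gaussExpect σ (P * Q) = gaussExpect σ (∑ i, X i * (pderiv i P * Q)) := by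
    have h2 : ∑ i, X i * (pderiv i P * Q) = k • (P * Q) := by
      simp only [← mul_assoc, ← Finset.sum_mul, hP.sum_X_mul_pderiv, smul_mul_assoc]
    rw [h2, map_nsmul, nsmul_eq_mul]
  have h3 : ∀ i : σ, pderiv i (pderiv i P * Q) =
      pderiv i P * pderiv i Q + pderiv i (pderiv i P) * Q := by
    intro i
    rw [Derivation.leibniz, smul_eq_mul, smul_eq_mul, mul_comm Q]
  rw [h1, map_sum]
  simp only [gaussExpect_X_mul, h3]
  rw [← map_sum, Finset.sum_add_distrib, ← Finset.sum_mul]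
  have h4 : ∑ i, pderiv i (pderiv i P) = 0 := hΔ
  rw [h4, zero_mul, add_zero]

theorem isHomogeneous_dirDeriv (x : σ → ℝ) {k : ℕ} {P : MvPolynomial σ ℝ}
    (hP : P.IsHomogeneous (k + 1)) : (dirDeriv x P).IsHomogeneous k := by
  rw [dirDeriv_apply]
  refine IsHomogeneous.sum Finset.univ (fun i => C (x i) * pderiv i P) k fun i _ => ?_
  have h := (isHomogeneous_C σ (x i)).mul (hP.pderiv (i := i))
  rwa [zero_add, Nat.add_sub_cancel] at h

theorem polyLaplacian_dirDeriv (x : σ → ℝ) {P : MvPolynomial σ ℝ} (hΔ : polyLaplacian P = 0) :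
    polyLaplacian (dirDeriv x P) = 0 := by
  have hcomm : ∀ i j : σ, ∀ Q : MvPolynomial σ ℝ,
      pderiv i (pderiv j Q) = pderiv j (pderiv i Q) := by
    intro i j Q
    have : ⁅(pderiv i : Derivation ℝ (MvPolynomial σ ℝ) (MvPolynomial σ ℝ)),
        (pderiv j : Derivation ℝ (MvPolynomial σ ℝ) (MvPolynomial σ ℝ))⁆ = 0 := by
      classical
      refine derivation_ext fun k => ?_
      simp only [Derivation.commutator_apply, pderiv_X, Derivation.coe_zero, Pi.zero_apply]
      simp [Pi.single_apply, apply_ite]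
    have h2 := congrArg (fun D => D Q) this
    simpa [Derivation.commutator_apply, sub_eq_zero] using h2
  have h : ∀ i, pderiv i (pderiv i (dirDeriv x P)) = dirDeriv x (pderiv i (pderiv i P)) := by
    intro i
    simp only [dirDeriv_apply, map_sum, pderiv_C_mul]
    refine Finset.sum_congr rfl fun j _ => ?_
    rw [hcomm i j, hcomm i j]
  simp only [polyLaplacian] at hΔ ⊢
  simp only [h]
  rw [← map_sum, hΔ, map_zero]

theorem succ_mul_gaussExpect_mul_linForm_pow (x : σ → ℝ) {k : ℕ} {P : MvPolynomial σ ℝ}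
    (hP : P.IsHomogeneous k) (hΔ : polyLaplacian P = 0) (m : ℕ) :
    k * gaussExpect σ (P * linForm x ^ (m + 1)) =
      (m + 1) * gaussExpect σ (dirDeriv x P * linForm x ^ m) := by
  rw [natCast_mul_gaussExpect_mul hP hΔ]
  have h : ∑ i, pderiv i P * pderiv i (linForm x ^ (m + 1)) =
      (m + 1) • (dirDeriv x P * linForm x ^ m) := by
    rw [dirDeriv_apply, Finset.sum_mul, Finset.smul_sum]
    refine Finset.sum_congr rfl fun i _ => ?_
    rw [Derivation.leibniz_pow, pderiv_linForm]
    simp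
    ring
  rw [h, map_nsmul, nsmul_eq_mul]
  push_cast
  rfl

theorem gaussExpect_mul_linForm_pow_eq_zero (x : σ → ℝ) :
    ∀ {k m : ℕ} {P : MvPolynomial σ ℝ}, P.IsHomogeneous k → polyLaplacian P = 0 → m < k →
      gaussExpect σ (P * linForm x ^ m) = 0 := by
  intro k m
  induction m generalizing k with
  | zero =>
    intro P hP hΔ hk
    have h := natCast_mul_gaussExpect_mul hP hΔ 1
    simp at h
    rcases h with h | h
    · omega
    · simpa using h
  | succ m ih =>
    intro P hP hΔ hk
    obtain ⟨k, rfl⟩ : ∃ j, k = j + 1 := ⟨k - 1, by omega⟩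
    have h := succ_mul_gaussExpect_mul_linForm_pow x hP hΔ m
    rw [ih (isHomogeneous_dirDeriv x hP) (polyLaplacian_dirDeriv x hΔ) (by omega), mul_zero] at h
    exact (mul_eq_zero.1 h).resolve_left (by positivity)

theorem gaussExpect_mul_linForm_pow_self (x : σ → ℝ) :
    ∀ {k : ℕ} {P : MvPolynomial σ ℝ}, P.IsHomogeneous k → polyLaplacian P = 0 →
      gaussExpect σ (P * linForm x ^ k) = k.factorial * eval x P * gaussExpect σ 1 := by
  intro k
  induction k with
  | zero =>
    intro P hP _
    rw [totalDegree_eq_zero_iff_eq_C.1 (Nat.le_zero.1 hP.totalDegree_le)]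
    rw [pow_zero, mul_one, eval_C, ← mul_one (C _), ← smul_eq_C_mul, map_smul]
    simp
  | succ k ih =>
    intro P hP hΔ
    have h := succ_mul_gaussExpect_mul_linForm_pow x hP hΔ k
    rw [ih (isHomogeneous_dirDeriv x hP) (polyLaplacian_dirDeriv x hΔ)] at h
    have he : eval x (dirDeriv x P) = (k + 1) * eval x P := by
      have h2 := congrArg (eval x) hP.sum_X_mul_pderiv
      rw [dirDeriv_apply]
      simpa using h2
    rw [he] at h
    have hk : ((k : ℝ) + 1) ≠ 0 := by positivity
    refine mul_left_cancel₀ hk ?_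
    push_cast [Nat.factorial_succ] at h ⊢
    rw [h]
    ring

theorem integrable_eval_mul_gauss (P : MvPolynomial σ ℝ) :
    Integrable (fun y : σ → ℝ => eval y P * Real.exp (-(1 / 2) * ∑ i, y i ^ 2)) ∧
      ∫ y : σ → ℝ, eval y P * Real.exp (-(1 / 2) * ∑ i, y i ^ 2) = gaussExpect σ P := by
  induction P using MvPolynomial.induction_on' with
  | monomial s a =>
    have h : ∀ y : σ → ℝ, eval y (monomial s a) * Real.exp (-(1 / 2) * ∑ i, y i ^ 2) =
        a * ∏ i, (y i ^ s i * Real.exp (-(1 / 2) * y i ^ 2)) := by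
      intro y
      rw [eval_monomial, Finset.mul_sum, Real.exp_sum, Finset.prod_mul_distrib,
        Finsupp.prod_fintype _ _ (by simp)]
      ring
    simp only [h]
    refine ⟨(Integrable.fintype_prod
      (f := fun i (x : ℝ) => x ^ s i * Real.exp (-(1 / 2) * x ^ 2))
      fun i => integrable_pow_mul_gauss (s i)).const_mul a, ?_⟩
    rw [integral_const_mul, gaussExpect_monomial, volume_pi,
      integral_fintype_prod_eq_prod (fun i (x : ℝ) => x ^ s i * Real.exp (-(1 / 2) * x ^ 2))]
    rfl
  | add p q hp hq =>
    simp only [map_add, add_mul]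
    exact ⟨hp.1.add hq.1, by rw [integral_add hp.1 hq.1, hp.2, hq.2]⟩

end GaussianFunctional

section PolarCoordinates

instance instIsFiniteMeasureSphMeasure (N : ℕ) : IsFiniteMeasure (sphMeasure N) := by
  unfold sphMeasure
  infer_instance

theorem measurePreserving_polar (N : ℕ) :
    MeasurePreserving (homeomorphUnitSphereProd (EuclideanSpace ℝ (Fin (N + 1))))
      (volume.comap Subtype.val) ((sphMeasure N).prod (.volumeIoiPow N)) := by
  have h := (volume : Measure (EuclideanSpace ℝ (Fin (N + 1))))
    |>.measurePreserving_homeomorphUnitSphereProd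
  rwa [finrank_euclideanSpace_fin, Nat.add_sub_cancel] at h

theorem homeomorphUnitSphereProd_smul {N : ℕ}
    (x : ({0}ᶜ : Set (EuclideanSpace ℝ (Fin (N + 1))))) :
    ((homeomorphUnitSphereProd _ x).2 : ℝ) • ((homeomorphUnitSphereProd _ x).1 :
      EuclideanSpace ℝ (Fin (N + 1))) = x := by
  rw [homeomorphUnitSphereProd_apply_snd_coe, homeomorphUnitSphereProd_apply_fst_coe]
  have : ‖(x : EuclideanSpace ℝ (Fin (N + 1)))‖ ≠ 0 := norm_ne_zero_iff.2 x.2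
  rw [smul_smul, mul_inv_cancel₀ this, one_smul]

theorem integral_polar {N : ℕ} (F : EuclideanSpace ℝ (Fin (N + 1)) → ℝ) :
    ∫ x, F x = ∫ p : Sph N × Set.Ioi (0 : ℝ),
      F ((p.2 : ℝ) • (p.1 : EuclideanSpace ℝ (Fin (N + 1)))) ∂((sphMeasure N).prod
        (.volumeIoiPow N)) := by
  have h := (measurePreserving_polar N).integral_comp (Homeomorph.measurableEmbedding _)
    fun p : Sph N × Set.Ioi (0 : ℝ) => F ((p.2 : ℝ) • (p.1 : EuclideanSpace ℝ (Fin (N + 1))))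
  rw [← h]
  simp only [homeomorphUnitSphereProd_smul]
  rw [integral_subtype_comap (measurableSet_singleton _).compl F, restrict_compl_singleton]

theorem lintegral_polar {N : ℕ} (F : EuclideanSpace ℝ (Fin (N + 1)) → ℝ≥0∞) :
    ∫⁻ x, F x = ∫⁻ p : Sph N × Set.Ioi (0 : ℝ),
      F ((p.2 : ℝ) • (p.1 : EuclideanSpace ℝ (Fin (N + 1)))) ∂((sphMeasure N).prod
        (.volumeIoiPow N)) := by
  have h := (measurePreserving_polar N).lintegral_comp_emb (Homeomorph.measurableEmbedding _)
    fun p : Sph N × Set.Ioi (0 : ℝ) => F ((p.2 : ℝ) • (p.1 : EuclideanSpace ℝ (Fin (N + 1))))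
  rw [← h]
  simp only [homeomorphUnitSphereProd_smul]
  rw [lintegral_subtype_comap (measurableSet_singleton _).compl F, restrict_compl_singleton]

/-- The radial part of the Gaussian moments in `ℝ^{N+1}`. -/
def radialMoment (N m : ℕ) : ℝ :=
  ∫ r : Set.Ioi (0 : ℝ), (r : ℝ) ^ m * Real.exp (-(1 / 2) * (r : ℝ) ^ 2) ∂(.volumeIoiPow N)

theorem radialMoment_eq (N m : ℕ) : radialMoment N m =
    (1 / 2 : ℝ) ^ (-((m + N + 1 : ℝ) / 2)) * (1 / 2) * Real.Gamma ((m + N + 1 : ℝ) / 2) := by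
  have h := integral_rpow_mul_exp_neg_mul_rpow (p := 2) (q := m + N) (b := 1 / 2) (by norm_num)
    (by linarith [(Nat.cast_nonneg m : (0 : ℝ) ≤ m), (Nat.cast_nonneg N : (0 : ℝ) ≤ N)])
    (by norm_num)
  rw [← neg_div, ← h, radialMoment]
  simp only [Measure.volumeIoiPow, ENNReal.ofReal]
  rw [integral_withDensity_eq_integral_smul
    (measurable_subtype_coe.pow_const _).real_toNNReal,
    integral_subtype_comap measurableSet_Ioi
      fun a : ℝ => Real.toNNReal (a ^ N) • (a ^ m * Real.exp (-(1 / 2) * a ^ 2))]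
  refine setIntegral_congr_fun measurableSet_Ioi fun x hx => ?_
  have hx' : 0 < x := hx
  simp only [NNReal.smul_def, Real.coe_toNNReal _ (pow_nonneg hx'.le _), smul_eq_mul]
  rw [Real.rpow_add hx', Real.rpow_natCast, Real.rpow_natCast, Real.rpow_two]
  ring

theorem radialMoment_pos (N m : ℕ) : 0 < radialMoment N m := by
  rw [radialMoment_eq]
  have : 0 < Real.Gamma ((m + N + 1 : ℝ) / 2) := Real.Gamma_pos_of_pos (by positivity)
  positivity

theorem radialMoment_add_two (N m : ℕ) :
    radialMoment N (m + 2) = (m + N + 1) * radialMoment N m := by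
  rw [radialMoment_eq, radialMoment_eq]
  have h : (((m + 2 : ℕ) : ℝ) + N + 1) / 2 = (m + N + 1 : ℝ) / 2 + 1 := by
    push_cast
    ring
  rw [h, Real.Gamma_add_one (by positivity), neg_add, Real.rpow_add (by norm_num),
    Real.rpow_neg_one]
  ring

theorem eval_smul_of_isHomogeneous {σ : Type*} [Fintype σ] {m : ℕ} {P : MvPolynomial σ ℝ}
    (hP : P.IsHomogeneous m) (r : ℝ) (x : σ → ℝ) :
    MvPolynomial.eval (r • x) P = r ^ m * MvPolynomial.eval x P := by
  rw [MvPolynomial.eval_eq', MvPolynomial.eval_eq', Finset.mul_sum]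
  refine Finset.sum_congr rfl fun d hd => ?_
  have h : ∑ i, d i = m := by
    rw [← hP (MvPolynomial.mem_support_iff.1 hd), Finsupp.weight_apply,
      Finsupp.sum_fintype _ _ (by simp)]
    simp
  simp only [Pi.smul_apply, smul_eq_mul, mul_pow, Finset.prod_mul_distrib]
  rw [Finset.prod_pow_eq_pow_sum, h]
  ring

/-- Spherical integration of a polynomial. -/
theorem gaussExpect_eq_radialMoment_mul {N m : ℕ} {P : MvPolynomial (Fin (N + 1)) ℝ}
    (hP : P.IsHomogeneous m) :
    gaussExpect (Fin (N + 1)) P = radialMoment N m * ∫ y : Sph N, MvPolynomial.eval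
      (fun i => (y : EuclideanSpace ℝ (Fin (N + 1))) i) P ∂(sphMeasure N) := by
  rw [← (integrable_eval_mul_gauss P).2, ← (PiLp.volume_preserving_ofLp (Fin (N + 1))).integral_comp
    (MeasurableEquiv.toLp 2 (Fin (N + 1) → ℝ)).symm.measurableEmbedding, integral_polar, mul_comm,
    radialMoment, ← integral_prod_mul]
  refine integral_congr_ae (Eventually.of_forall fun p => ?_)
  have h1 : ∑ i, ((p.2 : ℝ) • (p.1 : EuclideanSpace ℝ (Fin (N + 1)))) i ^ 2 = (p.2 : ℝ) ^ 2 := by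
    rw [← EuclideanSpace.real_norm_sq_eq, norm_smul, norm_eq_of_mem_sphere]
    simp
  have h2 : MvPolynomial.eval ((p.2 : ℝ) • (p.1 : EuclideanSpace ℝ (Fin (N + 1)))).ofLp P =
      (p.2 : ℝ) ^ m * MvPolynomial.eval (p.1 : EuclideanSpace ℝ (Fin (N + 1))).ofLp P :=
    eval_smul_of_isHomogeneous hP _ _
  simp only [h1, h2]
  ring

end PolarCoordinates

section ReproducingKernel

open MvPolynomial

/-- The leading coefficient of the Gegenbauer polynomial of degree `k`. -/
def gegenbauerLeading (l : ℝ) : ℕ → ℝ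
  | 0 => 1
  | k + 1 => 2 * (k + l) / (k + 1) * gegenbauerLeading l k

theorem gaussExpect_mul_linForm_pow_mul_gegenbauerSeq {σ : Type*} [Fintype σ] (l : ℝ) (x : σ → ℝ)
    {k : ℕ} {P : MvPolynomial σ ℝ} (hP : P.IsHomogeneous k) (hΔ : polyLaplacian P = 0) (j : ℕ) :
    (∀ m, m + j < k → gaussExpect σ
      (P * (linForm x ^ m * gegenbauerSeq l (linForm x) (normSqPoly σ) j)) = 0) ∧
    ∀ m, m + j = k → gaussExpect σ
      (P * (linForm x ^ m * gegenbauerSeq l (linForm x) (normSqPoly σ) j)) =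
        gegenbauerLeading l j * gaussExpect σ (P * linForm x ^ k) := by
  induction j using Nat.strong_induction_on with
  | _ j ih =>
    match j with
    | 0 =>
      refine ⟨fun m hm => ?_, fun m hm => ?_⟩
      · simpa [gegenbauerSeq] using gaussExpect_mul_linForm_pow_eq_zero x hP hΔ hm
      · obtain rfl : m = k := hm
        simp [gegenbauerSeq, gegenbauerLeading]
    | 1 =>
      have h : ∀ m, P * (linForm x ^ m * gegenbauerSeq l (linForm x) (normSqPoly σ) 1) =
          (2 * l) • (P * linForm x ^ (m + 1)) := by
        intro m
        simp only [gegenbauerSeq, smul_eq_C_mul, algebraMap_eq, map_mul, map_ofNat]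
        ring
      refine ⟨fun m hm => ?_, fun m hm => ?_⟩
      · rw [h, map_smul, gaussExpect_mul_linForm_pow_eq_zero x hP hΔ hm, smul_zero]
      · subst hm
        rw [h, map_smul]
        simp [gegenbauerLeading]
    | j + 2 =>
      have h : ∀ m, m + j < k →
          (j + 2 : ℝ) * gaussExpect σ
            (P * (linForm x ^ m * gegenbauerSeq l (linForm x) (normSqPoly σ) (j + 2))) =
          2 * (j + 1 + l) * gaussExpect σ
            (P * (linForm x ^ (m + 1) * gegenbauerSeq l (linForm x) (normSqPoly σ) (j + 1))) := by
        intro m hm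
        have e : (j + 2 : ℝ) •
            (P * (linForm x ^ m * gegenbauerSeq l (linForm x) (normSqPoly σ) (j + 2))) =
            (2 * (j + 1 + l)) •
              (P * (linForm x ^ (m + 1) * gegenbauerSeq l (linForm x) (normSqPoly σ) (j + 1))) -
            (j + 2 * l) • (normSqPoly σ *
              (P * (linForm x ^ m * gegenbauerSeq l (linForm x) (normSqPoly σ) j))) := by
          have hr := gegenbauerSeq_rec l (linForm x) (normSqPoly σ) j
          simp only [smul_eq_C_mul, algebraMap_eq, map_mul, map_ofNat, map_add, map_natCast,
            map_one] at hr ⊢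
          linear_combination P * linForm x ^ m * hr
        have hh := congrArg (gaussExpect σ) e
        rw [map_sub, map_smul, map_smul, map_smul, gaussExpect_normSqPoly_mul (hP.mul
          (((isHomogeneous_linForm x).pow m).mul (isHomogeneous_gegenbauerSeq l x j))),
          (ih j (by omega)).1 m hm, mul_zero, smul_zero, sub_zero] at hh
        exact hh
      have hj : (j + 2 : ℝ) ≠ 0 := by positivity
      refine ⟨fun m hm => ?_, fun m hm => ?_⟩
      · have h1 := h m (by omega)
        rw [(ih (j + 1) (by omega)).1 (m + 1) (by omega), mul_zero] at h1
        exact (mul_eq_zero.1 h1).resolve_left hj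
      · have h1 := h m (by omega)
        rw [(ih (j + 1) (by omega)).2 (m + 1) (by omega)] at h1
        refine mul_left_cancel₀ hj ?_
        rw [h1, show gegenbauerLeading l (j + 2) = 2 * ((j + 1 : ℕ) + l) / ((j + 1 : ℕ) + 1) *
          gegenbauerLeading l (j + 1) from rfl]
        push_cast
        rw [show (j : ℝ) + 1 + 1 = j + 2 by ring]
        field_simp

theorem gegenbauerLeading_mul_factorial {N : ℕ} {l : ℝ} (hl : 2 * l + 2 = N + 1) (k : ℕ) :
    gegenbauerLeading l k * k.factorial * (k + l) * radialMoment N 0 =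
      l * radialMoment N (2 * k) := by
  induction k with
  | zero => simp [gegenbauerLeading]
  | succ k ih =>
    rw [show 2 * (k + 1) = 2 * k + 2 by ring, radialMoment_add_two, gegenbauerLeading,
      Nat.factorial_succ]
    have hN : (N : ℝ) = 2 * l + 1 := by linarith
    push_cast
    rw [hN]
    have hk : (k + 1 : ℝ) ≠ 0 := by positivity
    field_simp
    linear_combination (2 * (k + l + 1)) * ih

theorem inner_eq_sum {N : ℕ} (x y : EuclideanSpace ℝ (Fin (N + 1))) :
    ⟪x, y⟫ = ∑ i, x i * y i := by
  simp [PiLp.inner_apply, mul_comm]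

theorem sum_sq_sphere {N : ℕ} (x : Sph N) :
    ∑ i, (x : EuclideanSpace ℝ (Fin (N + 1))) i ^ 2 = 1 := by
  rw [← EuclideanSpace.real_norm_sq_eq, norm_eq_of_mem_sphere, one_pow]

theorem eval_gegenbauerSeq_sphere {N : ℕ} (l : ℝ) (x y : Sph N) (k : ℕ) :
    eval (y : EuclideanSpace ℝ (Fin (N + 1))).ofLp
      (gegenbauerSeq l (linForm (x : EuclideanSpace ℝ (Fin (N + 1))).ofLp) (normSqPoly _) k) =
      gegenbauerSeq l (⟪(x : EuclideanSpace ℝ (Fin (N + 1))), y⟫ : ℝ) 1 k := by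
  have h := map_gegenbauerSeq (aeval (y : EuclideanSpace ℝ (Fin (N + 1))).ofLp) l
    (linForm (x : EuclideanSpace ℝ (Fin (N + 1))).ofLp) (normSqPoly _) k
  have h1 : aeval (y : EuclideanSpace ℝ (Fin (N + 1))).ofLp
      (linForm (x : EuclideanSpace ℝ (Fin (N + 1))).ofLp) =
      ⟪(x : EuclideanSpace ℝ (Fin (N + 1))), y⟫ := by
    rw [inner_eq_sum]
    simp [linForm]
  have h2 : aeval (y : EuclideanSpace ℝ (Fin (N + 1))).ofLp (normSqPoly (Fin (N + 1))) =
      (1 : ℝ) :=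
    Eq.trans (by simp [normSqPoly]) (sum_sq_sphere y)
  rw [h1, h2] at h
  rw [← h]
  rfl

theorem isSphericalHarmonic_gegenbauerSeq {N : ℕ} {l : ℝ} (hl : 2 * l + 2 = N + 1) (x : Sph N)
    (k : ℕ) : IsSphericalHarmonic N k fun y =>
      gegenbauerSeq l (⟪(x : EuclideanSpace ℝ (Fin (N + 1))), y⟫ : ℝ) 1 k :=
  ⟨_, isHomogeneous_gegenbauerSeq l _ k,
    polyLaplacian_gegenbauerSeq l (by simpa using hl) _ (sum_sq_sphere x) k,
    fun y => (eval_gegenbauerSeq_sphere l x y k).symm⟩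

theorem integral_mul_gegenbauerSeq {N : ℕ} {l : ℝ} (hl : 2 * l + 2 = N + 1) (x : Sph N) {k : ℕ}
    {g : Sph N → ℝ} (hg : IsSphericalHarmonic N k g) :
    (k + l) * ∫ y, g y * gegenbauerSeq l (⟪(x : EuclideanSpace ℝ (Fin (N + 1))), y⟫ : ℝ) 1 k
      ∂(sphMeasure N) = l * (sphMeasure N).real Set.univ * g x := by
  obtain ⟨P, hP, hΔ, hgP⟩ := hg
  have h1 := (gaussExpect_mul_linForm_pow_mul_gegenbauerSeq l
    (x : EuclideanSpace ℝ (Fin (N + 1))).ofLp hP hΔ k).2 0 (zero_add k)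
  rw [gaussExpect_mul_linForm_pow_self _ hP hΔ, pow_zero, one_mul,
    gaussExpect_eq_radialMoment_mul (hP.mul (isHomogeneous_gegenbauerSeq l _ k)),
    gaussExpect_eq_radialMoment_mul (isHomogeneous_one _ _)] at h1
  have h2 : ∀ y : Sph N, eval (fun i => (y : EuclideanSpace ℝ (Fin (N + 1))) i)
      (P * gegenbauerSeq l (linForm (x : EuclideanSpace ℝ (Fin (N + 1))).ofLp) (normSqPoly _) k) =
      g y * gegenbauerSeq l (⟪(x : EuclideanSpace ℝ (Fin (N + 1))), y⟫ : ℝ) 1 k := by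
    intro y
    rw [map_mul, hgP]
    congr 1
    exact eval_gegenbauerSeq_sphere l x y k
  have h3 := gegenbauerLeading_mul_factorial hl k
  rw [hgP x]
  simp only [h2, map_one, integral_const, smul_eq_mul, mul_one, ← two_mul] at h1
  refine mul_left_cancel₀ (radialMoment_pos N (2 * k)).ne' ?_
  linear_combination (k + l) * h1 +
    (sphMeasure N).real Set.univ * eval (fun i => (x : EuclideanSpace ℝ (Fin (N + 1))) i) P * h3

end ReproducingKernel

section CesaroKernel

variable {N : ℕ} {a : ℕ → ℕ} {Y : (k : ℕ) → Fin (a k) → Sph N → ℝ}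

theorem IsSphericalHarmonic.continuous {k : ℕ} {g : Sph N → ℝ} (hg : IsSphericalHarmonic N k g) :
    Continuous g := by
  obtain ⟨P, -, -, hP⟩ := hg
  rw [funext hP]
  refine (MvPolynomial.continuous_eval P).comp (continuous_pi fun i => ?_)
  fun_prop

theorem integrable_of_continuous_sphere {g : Sph N → ℝ} (hg : Continuous g) :
    Integrable g (sphMeasure N) :=
  hg.integrable_of_hasCompactSupport (HasCompactSupport.of_compactSpace g)

theorem sphMeasure_real_univ_pos (N : ℕ) : 0 < (sphMeasure N).real Set.univ := by
  refine ENNReal.toReal_pos ?_ (measure_ne_top _ _)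
  rw [Ne, Measure.measure_univ_eq_zero]
  exact Measure.toSphere_ne_zero _

/-- The addition theorem for spherical harmonics. -/
theorem IsFourierLaplaceBasis.sum_mul_eq (hY : IsFourierLaplaceBasis N a Y) {l : ℝ}
    (hl : 2 * l + 2 = N + 1) (k : ℕ) (x y : Sph N) :
    l * (sphMeasure N).real Set.univ * ∑ j, Y k j x * Y k j y =
      (k + l) * gegenbauerSeq l (⟪(x : EuclideanSpace ℝ (Fin (N + 1))), y⟫ : ℝ) 1 k := by
  obtain ⟨c, hc⟩ := (Submodule.mem_span_range_iff_exists_fun ℝ).1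
    (hY.spanning k _ (isSphericalHarmonic_gegenbauerSeq hl x k))
  have hc' : ∀ y : Sph N, gegenbauerSeq l (⟪(x : EuclideanSpace ℝ (Fin (N + 1))), y⟫ : ℝ) 1 k =
      ∑ j, c j * Y k j y := by
    intro y
    have := congrFun hc y
    simpa using this.symm
  have h : ∀ i, (k + l) * c i = l * (sphMeasure N).real Set.univ * Y k i x := by
    intro i
    rw [← integral_mul_gegenbauerSeq hl x (hY.harmonic k i)]
    congr 1
    simp only [hc', Finset.mul_sum]
    rw [integral_finsetSum]
    · have : ∀ j, ∫ y, Y k i y * (c j * Y k j y) ∂(sphMeasure N) = if i = j then c j else 0 := by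
        intro j
        simp only [mul_left_comm _ (c j)]
        rw [integral_const_mul, hY.orthonormal]
        simp
      simp [this]
    · intro j _
      exact integrable_of_continuous_sphere
        ((hY.harmonic k i).continuous.mul (continuous_const.mul (hY.harmonic k j).continuous))
  rw [hc', Finset.mul_sum, Finset.mul_sum]
  refine Finset.sum_congr rfl fun j _ => ?_
  linear_combination (-Y k j y) * h j

theorem IsFourierLaplaceBasis.cesaroMean_eq_integral (hY : IsFourierLaplaceBasis N a Y) (α : ℝ)
    {f : Sph N → ℝ} (hf : Integrable f (sphMeasure N)) (n : ℕ) (x : Sph N) :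
    cesaroMean Y α f n x = ∫ y, f y * cesaroKernel Y α n x y ∂(sphMeasure N) := by
  have hi : ∀ k j, Integrable (fun y => f y * Y k j y) (sphMeasure N) := by
    intro k j
    have hc := (hY.harmonic k j).continuous
    obtain ⟨C, hC⟩ := isCompact_univ.exists_bound_of_continuousOn hc.continuousOn
    exact hf.mul_bdd hc.aestronglyMeasurable (Eventually.of_forall fun y => hC y trivial)
  have h : ∀ y, f y * cesaroKernel Y α n x y = ∑ k ∈ Finset.range (n + 1), ∑ j,
      ((cesaroA α n)⁻¹ * (cesaroA α (n - k) * Y k j x)) * (f y * Y k j y) := by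
    intro y
    simp only [cesaroKernel, Finset.mul_sum]
    refine Finset.sum_congr rfl fun k _ => Finset.sum_congr rfl fun j _ => ?_
    ring
  simp only [h]
  rw [integral_finsetSum]
  · simp only [cesaroMean, Finset.mul_sum]
    refine Finset.sum_congr rfl fun k _ => ?_
    rw [integral_finsetSum]
    · refine Finset.sum_congr rfl fun j _ => ?_
      rw [integral_const_mul, flCoeff]
      ring
    · exact fun j _ => (hi k j).const_mul _
  · exact fun k _ => integrable_finsetSum _ fun j _ => (hi k j).const_mul _

theorem IsFourierLaplaceBasis.exists_cesaroKernel_le (hY : IsFourierLaplaceBasis N a Y) {l τ : ℝ}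
    (hl0 : 0 < l) (hl : 2 * l + 2 = N + 1) (hτ : 0 < τ) :
    ∃ C, 0 ≤ C ∧ ∀ x y : Sph N, -1 < (⟪(x : EuclideanSpace ℝ (Fin (N + 1))), y⟫ : ℝ) →
      (⟪(x : EuclideanSpace ℝ (Fin (N + 1))), y⟫ : ℝ) ≤ 1 - 2 * τ → ∀ n, 1 ≤ n →
      |cesaroKernel Y l n x y| ≤
        C * √(1 - (⟪(x : EuclideanSpace ℝ (Fin (N + 1))), y⟫ : ℝ) ^ 2) ^ (-(l + 1)) := by
  obtain ⟨C, hC0, hC⟩ := exists_cesaroSum_le hl0 hτ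
  obtain ⟨c, hc0, hc⟩ := exists_le_cesaroA hl0
  have hω := sphMeasure_real_univ_pos N
  set ω := (sphMeasure N).real Set.univ with hωdef
  refine ⟨c⁻¹ * ((l * ω)⁻¹ * C), by positivity, fun x y h1 h2 n hn => ?_⟩
  have hK : cesaroKernel Y l n x y = (cesaroA l n)⁻¹ * ((l * ω)⁻¹ *
      ∑ k ∈ Finset.range (n + 1), cesaroA l (n - k) * ((k + l) *
        gegenbauerSeq l (⟪(x : EuclideanSpace ℝ (Fin (N + 1))), y⟫ : ℝ) 1 k)) := by
    rw [cesaroKernel, Finset.mul_sum _ _ (l * ω)⁻¹]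
    congr 1
    refine Finset.sum_congr rfl fun k _ => ?_
    rw [← hY.sum_mul_eq hl, ← hωdef]
    field_simp
  have hn1 : (0 : ℝ) < (n + 1 : ℝ) ^ l := by positivity
  have hA : (0 : ℝ) < cesaroA l n := lt_of_lt_of_le (by positivity) (hc n hn)
  rw [hK, abs_mul, abs_mul, abs_of_pos (inv_pos.2 hA), abs_of_pos (by positivity : 0 < (l * ω)⁻¹)]
  calc _ ≤ (c * (n + 1 : ℝ) ^ l)⁻¹ * ((l * ω)⁻¹ *
        (C * √(1 - (⟪(x : EuclideanSpace ℝ (Fin (N + 1))), y⟫ : ℝ) ^ 2) ^ (-(l + 1)) *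
          (n + 1 : ℝ) ^ l)) := by
        gcongr
        · exact hc n hn
        · exact hC _ h1 h2 n hn
    _ = _ := by
        field_simp

end CesaroKernel

section SphericalWeight

theorem integrable_abs_rpow_mul_gauss {s : ℝ} (hs : -1 < s) :
    Integrable fun u : ℝ => |u| ^ s * Real.exp (-(1 / 2) * u ^ 2) := by
  have h : IntegrableOn (fun u : ℝ => |u| ^ s * Real.exp (-(1 / 2) * u ^ 2)) (Set.Ioi 0) := by
    refine (integrableOn_rpow_mul_exp_neg_mul_sq (b := 1 / 2) (by norm_num) hs).congr_fun
      (fun u hu => ?_) measurableSet_Ioi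
    simp only [abs_of_pos (Set.mem_Ioi.1 hu)]
  rw [← integrableOn_univ, ← Set.Iic_union_Ioi (a := (0 : ℝ)), integrableOn_union]
  refine ⟨?_, h⟩
  have hm : MeasurableEmbedding fun u : ℝ => -u := (Homeomorph.neg ℝ).measurableEmbedding
  rw [← Measure.map_neg_eq_self (volume : Measure ℝ), hm.integrableOn_map_iff]
  simpa [Function.comp_def, integrableOn_Ici_iff_integrableOn_Ioi] using h

/-- A Gaussian with power singularities along the coordinate hyperplanes. -/
def singularGauss {ι : Type*} [Fintype ι] (s : ι → ℝ) (w : ι → ℝ) : ℝ≥0∞ :=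
  (∏ i, ENNReal.ofReal |w i| ^ (-s i)) * ENNReal.ofReal (Real.exp (-(1 / 2) * ∑ i, w i ^ 2))

theorem lintegral_singularGauss_ne_top {ι : Type*} [Fintype ι] {s : ι → ℝ} (hs : ∀ i, s i < 1) :
    ∫⁻ w, singularGauss s w ≠ ⊤ := by
  have hi := Integrable.fintype_prod (μ := fun _ : ι => (volume : Measure ℝ))
    (f := fun i u => |u| ^ (-s i) * Real.exp (-(1 / 2) * u ^ 2))
    fun i => integrable_abs_rpow_mul_gauss (by linarith [hs i])
  have h : ∫⁻ w, singularGauss s w = ∫⁻ w : ι → ℝ, ENNReal.ofReal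
      (∏ i, |w i| ^ (-s i) * Real.exp (-(1 / 2) * w i ^ 2)) := by
    refine lintegral_congr_ae ?_
    have hne : ∀ᵐ w : ι → ℝ, ∀ i, w i ≠ 0 :=
      ae_all_iff.2 fun i => Measure.ae_eval_ne (fun _ => volume) i 0
    filter_upwards [hne] with w hw
    rw [singularGauss, Finset.prod_mul_distrib, ENNReal.ofReal_mul (by positivity),
      ENNReal.ofReal_prod_of_nonneg (fun i _ => by positivity), ← Real.exp_sum, ← Finset.mul_sum]
    congr 1
    exact Finset.prod_congr rfl fun i _ => ENNReal.ofReal_rpow_of_pos (abs_pos.2 (hw i))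
  rw [h]
  exact hi.lintegral_lt_top.ne

theorem singularGauss_smul {ι : Type*} [Fintype ι] (s : ι → ℝ) {r : ℝ} (w : ι → ℝ)
    (hw : ∑ i, w i ^ 2 = 1) :
    singularGauss s (r • w) = (∏ i, ENNReal.ofReal |w i| ^ (-s i)) *
      ((∏ i, ENNReal.ofReal |r| ^ (-s i)) * ENNReal.ofReal (Real.exp (-(1 / 2) * r ^ 2))) := by
  have h1 : ∑ i, (r • w) i ^ 2 = r ^ 2 := by
    simp only [Pi.smul_apply, smul_eq_mul, mul_pow, ← Finset.mul_sum, hw, mul_one]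
  rw [singularGauss, h1, ← mul_assoc, ← Finset.prod_mul_distrib]
  congr 1
  refine Finset.prod_congr rfl fun i _ => ?_
  rw [Pi.smul_apply, smul_eq_mul, abs_mul, ENNReal.ofReal_mul (abs_nonneg r), mul_comm,
    ENNReal.mul_rpow_of_ne_top ENNReal.ofReal_ne_top ENNReal.ofReal_ne_top]

/-- The singular weight `(1 - ⟨x, y⟩²)^(-q/2)` on the sphere. -/
def sphWeight {N : ℕ} (q : ℝ) (x y : Sph N) : ℝ≥0∞ :=
  ENNReal.ofReal √(1 - (⟪(x : EuclideanSpace ℝ (Fin (N + 1))), y⟫ : ℝ) ^ 2) ^ (-q)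

theorem sphWeight_le_prod {N : ℕ} (hN : 0 < N) {q : ℝ} (hq : 0 ≤ q) (x : Sph N)
    (b : OrthonormalBasis (Fin (N + 1)) ℝ (EuclideanSpace ℝ (Fin (N + 1)))) (y : Sph N)
    (hy : b 0 = y) : sphWeight q x y ≤
      ∏ i, ENNReal.ofReal |b.repr x i| ^ (-(if i = 0 then 0 else q / N)) := by
  have hsum : ∑ i, b.repr x i ^ 2 = 1 := by
    rw [← EuclideanSpace.real_norm_sq_eq, LinearIsometryEquiv.norm_map, norm_eq_of_mem_sphere,
      one_pow]
  have h0 : b.repr x 0 = ⟪(x : EuclideanSpace ℝ (Fin (N + 1))), y⟫ := by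
    rw [b.repr_apply_apply, hy, real_inner_comm]
  have hi : ∀ i : Fin N, |b.repr x i.succ| ≤
      √(1 - (⟪(x : EuclideanSpace ℝ (Fin (N + 1))), y⟫ : ℝ) ^ 2) := by
    intro i
    refine Real.abs_le_sqrt ?_
    have h1 := Finset.single_le_sum (f := fun i : Fin N => b.repr x i.succ ^ 2)
      (fun i _ => sq_nonneg _) (Finset.mem_univ i)
    rw [Fin.sum_univ_succ] at hsum
    rw [← h0]
    linarith
  rw [Fin.prod_univ_succ]
  simp only [if_true, neg_zero, ENNReal.rpow_zero, one_mul, Fin.succ_ne_zero, if_false]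
  have hW : sphWeight q x y = ∏ _i : Fin N,
      ENNReal.ofReal √(1 - (⟪(x : EuclideanSpace ℝ (Fin (N + 1))), y⟫ : ℝ) ^ 2) ^ (-(q / N)) := by
    have hN' : (N : ℝ) ≠ 0 := by positivity
    rw [Finset.prod_const, Finset.card_univ, Fintype.card_fin, ← ENNReal.rpow_mul_natCast,
      sphWeight]
    congr 1
    field_simp
  rw [hW]
  refine Finset.prod_le_prod' fun i _ => ?_
  rw [ENNReal.rpow_neg, ENNReal.rpow_neg]
  gcongr
  exact hi i

theorem exists_orthonormalBasis_zero_eq {N : ℕ} (y : Sph N) :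
    ∃ b : OrthonormalBasis (Fin (N + 1)) ℝ (EuclideanSpace ℝ (Fin (N + 1))), b 0 = y := by
  have h : Orthonormal ℝ (({0} : Set (Fin (N + 1))).domRestrict
      fun _ => (y : EuclideanSpace ℝ (Fin (N + 1)))) := by
    refine ⟨fun i => by simp [Set.domRestrict], fun i j hij => ?_⟩
    exact absurd (Subsingleton.elim i j) hij
  obtain ⟨b, hb⟩ := h.exists_orthonormalBasis_extension_of_card_eq (by simp)
  exact ⟨b, hb 0 rfl⟩

theorem exists_lintegral_sphWeight_le {N : ℕ} (hN : 2 ≤ N) :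
    ∃ K : ℝ≥0∞, K ≠ ⊤ ∧ ∀ y : Sph N,
      ∫⁻ x, sphWeight (((N : ℝ) + 1) / 2) x y ∂(sphMeasure N) ≤ K := by
  set q : ℝ := ((N : ℝ) + 1) / 2 with hq
  set s : Fin (N + 1) → ℝ := fun i => if i = 0 then 0 else q / N with hs
  have hN' : (2 : ℝ) ≤ N := by exact_mod_cast hN
  have hs1 : ∀ i, s i < 1 := by
    intro i
    simp only [hs]
    split_ifs
    · norm_num
    · rw [div_lt_one (by linarith)]
      linarith
  set ρ : Set.Ioi (0 : ℝ) → ℝ≥0∞ := fun r => (∏ i, ENNReal.ofReal |(r : ℝ)| ^ (-s i)) *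
    ENNReal.ofReal (Real.exp (-(1 / 2) * (r : ℝ) ^ 2)) with hρ
  have hρm : Measurable ρ := by fun_prop
  have hρ0 : ∫⁻ r, ρ r ∂(Measure.volumeIoiPow N) ≠ 0 := by
    rw [Ne, lintegral_eq_zero_iff hρm]
    intro h
    have hpos : ∀ r, ρ r ≠ 0 := by
      intro r
      simp only [hρ]
      refine mul_ne_zero (Finset.prod_ne_zero_iff.2 fun i _ => ?_)
        (ENNReal.ofReal_pos.2 (Real.exp_pos _)).ne'
      exact (ENNReal.rpow_pos (ENNReal.ofReal_pos.2 (abs_pos.2 (ne_of_gt r.2)))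
        ENNReal.ofReal_ne_top).ne'
    have h0 : Measure.volumeIoiPow N = 0 := by
      rw [← ae_eq_bot, ← Filter.eventually_false_iff_eq_bot]
      filter_upwards [h] with r hr using hpos r hr
    have h1 := Measure.volumeIoiPow_apply_Iio N ⟨1, Set.mem_Ioi.2 one_pos⟩
    rw [h0, Measure.coe_zero, Pi.zero_apply] at h1
    exact (ENNReal.ofReal_pos.2 (by positivity)).ne h1
  refine ⟨(∫⁻ w, singularGauss s w) / ∫⁻ r, ρ r ∂(Measure.volumeIoiPow N),
    ENNReal.div_ne_top (lintegral_singularGauss_ne_top hs1) hρ0, fun y => ?_⟩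
  obtain ⟨b, hb⟩ := exists_orthonormalBasis_zero_eq y
  rw [ENNReal.le_div_iff_mul_le (Or.inl hρ0) (Or.inr (lintegral_singularGauss_ne_top hs1))]
  have e1 : ∫⁻ w, singularGauss s w =
      ∫⁻ v : EuclideanSpace ℝ (Fin (N + 1)), singularGauss s (b.repr v).ofLp := by
    rw [← (PiLp.volume_preserving_ofLp (Fin (N + 1))).lintegral_comp_emb
      (MeasurableEquiv.toLp 2 (Fin (N + 1) → ℝ)).symm.measurableEmbedding,
      ← b.measurePreserving_repr.lintegral_comp_emb
      b.repr.toHomeomorph.measurableEmbedding]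
  rw [e1, lintegral_polar]
  calc _ ≤ (∫⁻ x : Sph N, ∏ i, ENNReal.ofReal |b.repr x i| ^ (-s i) ∂(sphMeasure N)) *
        ∫⁻ r, ρ r ∂(Measure.volumeIoiPow N) := by
        gcongr with x
        exact sphWeight_le_prod (by omega) (by positivity) x b y hb
    _ = ∫⁻ p : Sph N × Set.Ioi (0 : ℝ), (∏ i, ENNReal.ofReal |b.repr p.1 i| ^ (-s i)) *
        ρ p.2 ∂((sphMeasure N).prod (Measure.volumeIoiPow N)) := by
        rw [lintegral_prod_mul (f := fun x : Sph N => ∏ i, ENNReal.ofReal |b.repr x i| ^ (-s i))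
          (Measurable.aemeasurable (by fun_prop)) hρm.aemeasurable]
    _ = _ := by
        refine lintegral_congr fun p => ?_
        have hsum : ∑ i, b.repr p.1 i ^ 2 = 1 := by
          rw [← EuclideanSpace.real_norm_sq_eq, LinearIsometryEquiv.norm_map,
            norm_eq_of_mem_sphere, one_pow]
        rw [map_smul, WithLp.ofLp_smul, singularGauss_smul s _ hsum]

end SphericalWeight

section Localization

variable {N : ℕ}

theorem continuous_geoDist_left (y : Sph N) : Continuous fun x : Sph N => geoDist x y := by
  unfold geoDist
  exact Real.continuous_arccos.comp (by fun_prop)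

theorem geoDist_self (x : Sph N) : geoDist x x = 0 := by
  rw [geoDist, real_inner_self_eq_norm_sq, norm_eq_of_mem_sphere, one_pow, Real.arccos_one]

theorem closure_subset_of_le_geoDist {V V₁ : Set (Sph N)} (hV : IsOpen V) (hV₁V : V₁ ⊆ V) {δ : ℝ}
    (hδ : 0 < δ) (hdist : ∀ x ∈ V₁, ∀ y ∈ frontier V, δ ≤ geoDist x y) : closure V₁ ⊆ V := by
  intro x hx
  have h1 : x ∉ frontier V := by
    intro hxV
    have h2 : closure V₁ ⊆ {z | δ ≤ geoDist z x} :=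
      closure_minimal (fun z hz => hdist z hz x hxV)
        (isClosed_le continuous_const (continuous_geoDist_left x))
    have h3 : δ ≤ geoDist x x := h2 hx
    rw [geoDist_self] at h3
    linarith
  have h4 : x ∈ closure V \ frontier V := ⟨closure_mono hV₁V hx, h1⟩
  rwa [closure_sdiff_frontier, hV.interior_eq] at h4

theorem inner_sphere_mem_Icc (x y : Sph N) :
    (⟪(x : EuclideanSpace ℝ (Fin (N + 1))), y⟫ : ℝ) ∈ Set.Icc (-1) 1 := by
  have h := abs_real_inner_le_norm (x : EuclideanSpace ℝ (Fin (N + 1))) y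
  rw [norm_eq_of_mem_sphere, norm_eq_of_mem_sphere, one_mul] at h
  exact abs_le.1 h

theorem exists_inner_le {V V₁ : Set (Sph N)} (hV : IsOpen V) (hcl : closure V₁ ⊆ V) :
    ∃ τ : ℝ, 0 < τ ∧ ∀ x ∈ V₁, ∀ y ∉ V,
      (⟪(x : EuclideanSpace ℝ (Fin (N + 1))), y⟫ : ℝ) ≤ 1 - 2 * τ := by
  have hK : IsCompact (closure V₁ ×ˢ Vᶜ) :=
    isClosed_closure.isCompact.prod hV.isClosed_compl.isCompact
  have hc : Continuous fun p : Sph N × Sph N =>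
      (⟪(p.1 : EuclideanSpace ℝ (Fin (N + 1))), p.2⟫ : ℝ) := by
    fun_prop
  rcases (closure V₁ ×ˢ Vᶜ).eq_empty_or_nonempty with he | hne
  · refine ⟨1, one_pos, fun x hx y hy => ?_⟩
    have : (x, y) ∈ closure V₁ ×ˢ Vᶜ := ⟨subset_closure hx, hy⟩
    rw [he] at this
    exact this.elim
  · obtain ⟨p, hp, hmax⟩ := hK.exists_isMaxOn hne hc.continuousOn
    have hlt : (⟪(p.1 : EuclideanSpace ℝ (Fin (N + 1))), p.2⟫ : ℝ) < 1 := by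
      refine lt_of_le_of_ne (inner_sphere_mem_Icc _ _).2 fun h => ?_
      have h2 := (inner_eq_one_iff_of_norm_eq_one (norm_eq_of_mem_sphere p.1)
        (norm_eq_of_mem_sphere p.2)).1 h
      have h3 : p.1 = p.2 := Subtype.ext h2
      exact hp.2 (h3 ▸ hcl hp.1)
    refine ⟨(1 - (⟪(p.1 : EuclideanSpace ℝ (Fin (N + 1))), p.2⟫ : ℝ)) / 2, by linarith,
      fun x hx y hy => ?_⟩
    have h4 : (⟪(x : EuclideanSpace ℝ (Fin (N + 1))), y⟫ : ℝ) ≤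
        ⟪(p.1 : EuclideanSpace ℝ (Fin (N + 1))), p.2⟫ :=
      hmax (show (x, y) ∈ closure V₁ ×ˢ Vᶜ from ⟨subset_closure hx, hy⟩)
    linarith

theorem measurable_sphWeight (q : ℝ) :
    Measurable fun p : Sph N × Sph N => sphWeight q p.1 p.2 := by
  have hc : Continuous fun p : Sph N × Sph N =>
      √(1 - (⟪(p.1 : EuclideanSpace ℝ (Fin (N + 1))), p.2⟫ : ℝ) ^ 2) := by
    fun_prop
  exact hc.measurable.ennreal_ofReal.pow_const _

theorem IsFourierLaplaceBasis.exists_cesaroMaximal_le {a : ℕ → ℕ}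
    {Y : (k : ℕ) → Fin (a k) → Sph N → ℝ} (hY : IsFourierLaplaceBasis N a Y) {l τ : ℝ}
    (hl0 : 0 < l) (hl : 2 * l + 2 = N + 1) (hτ : 0 < τ) :
    ∃ C : ℝ≥0, ∀ f : Sph N → ℝ, Integrable f (sphMeasure N) → ∀ x : Sph N,
      (∀ y, f y ≠ 0 → (⟪(x : EuclideanSpace ℝ (Fin (N + 1))), y⟫ : ℝ) ≤ 1 - 2 * τ) →
      cesaroMaximal Y l f x ≤ C * ∫⁻ y, ‖f y‖ₑ * sphWeight (l + 1) x y ∂(sphMeasure N) := by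
  obtain ⟨C, hC0, hC⟩ := hY.exists_cesaroKernel_le hl0 hl hτ
  refine ⟨Real.toNNReal (C + 1), fun f hf x hx => iSup₂_le fun n hn => ?_⟩
  rw [hY.cesaroMean_eq_integral l hf, ← Real.enorm_eq_ofReal_abs,
    ← lintegral_const_mul' _ _ ENNReal.coe_ne_top]
  refine (enorm_integral_le_lintegral_enorm _).trans (lintegral_mono fun y => ?_)
  rw [enorm_mul, mul_left_comm]
  rcases eq_or_ne (f y) 0 with h0 | h0
  · simp [h0]
  gcongr
  have ht := hx y h0
  rcases (inner_sphere_mem_Icc x y).1.eq_or_lt with h1 | h1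
  · have hW : sphWeight (l + 1) x y = ⊤ := by
      rw [sphWeight, ← h1, neg_one_sq, sub_self, Real.sqrt_zero, ENNReal.ofReal_zero]
      exact ENNReal.zero_rpow_of_neg (by linarith)
    rw [hW, ENNReal.mul_top]
    · exact le_top
    · simp only [ne_eq, ENNReal.coe_eq_zero, Real.toNNReal_eq_zero, not_le]
      linarith
  · have hs : 0 < √(1 - (⟪(x : EuclideanSpace ℝ (Fin (N + 1))), y⟫ : ℝ) ^ 2) :=
      Real.sqrt_pos.2 (by nlinarith)
    rw [sphWeight, ENNReal.ofReal_rpow_of_pos hs, Real.enorm_eq_ofReal_abs,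
      ← ENNReal.ofReal.eq_1, ← ENNReal.ofReal_mul (by positivity)]
    refine ENNReal.ofReal_le_ofReal ((hC x y h1 ht n hn).trans ?_)
    gcongr
    linarith

theorem mul_sphMeasure_lt_le {q : ℝ} {K : ℝ≥0∞}
    (hK : ∀ y : Sph N, ∫⁻ x, sphWeight q x y ∂(sphMeasure N) ≤ K) (C : ℝ≥0) {f : Sph N → ℝ}
    (hf : Integrable f (sphMeasure N)) (ε : ℝ≥0∞) :
    ε * sphMeasure N {x | ε ≤ C * ∫⁻ y, ‖f y‖ₑ * sphWeight q x y ∂(sphMeasure N)} ≤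
      C * K * eLpNorm f 1 (sphMeasure N) := by
  have hm : AEMeasurable (fun p : Sph N × Sph N => ‖f p.2‖ₑ * sphWeight q p.1 p.2)
      ((sphMeasure N).prod (sphMeasure N)) :=
    (hf.aestronglyMeasurable.comp_snd.enorm).mul (measurable_sphWeight q).aemeasurable
  refine (mul_meas_ge_le_lintegral₀ (hm.lintegral_prod_right'.const_mul _) ε).trans ?_
  rw [lintegral_const_mul' _ _ ENNReal.coe_ne_top, lintegral_lintegral_swap hm,
    eLpNorm_one_eq_lintegral_enorm, mul_assoc,
    ← lintegral_const_mul'' _ hf.aestronglyMeasurable.enorm]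
  gcongr with y
  dsimp only
  rw [lintegral_const_mul' _ _ enorm_ne_top, mul_comm K]
  gcongr
  exact hK y

end Localization

/-- For `N ≥ 2`, `f ∈ L¹(S^N)` vanishing on `V`, a subdomain `V₁ ⊂ V` at
positive distance `δ` from `∂V`, and the critical order `α = (N−1)/2`, one has the weak
type estimate `σ{x ∈ V₁ : S_*^α f(x) > μ} ≤ c ‖f‖₁ / μ` with `c` not depending on `f`. -/
theorem cesaro_maximal_localized_weak_type
    (N : ℕ) (hN : 2 ≤ N) (a : ℕ → ℕ) (Y : (k : ℕ) → Fin (a k) → Sph N → ℝ)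
    (hY : IsFourierLaplaceBasis N a Y)
    (V V₁ : Set (Sph N)) (hV : IsOpen V) (hV₁ : IsOpen V₁) (hV₁V : V₁ ⊆ V)
    (δ : ℝ) (hδ : 0 < δ) (hdist : ∀ x ∈ V₁, ∀ y ∈ frontier V, δ ≤ geoDist x y) :
    ∃ c : ℝ≥0, ∀ f : Sph N → ℝ, Integrable f (sphMeasure N) → (∀ x ∈ V, f x = 0) →
      ∀ μ : ℝ, 0 < μ →
        sphMeasure N
            {x : Sph N | x ∈ V₁ ∧
              ENNReal.ofReal μ < cesaroMaximal Y (((N : ℝ) - 1) / 2) f x} ≤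
          c * eLpNorm f 1 (sphMeasure N) / ENNReal.ofReal μ := by
  have hN' : (2 : ℝ) ≤ N := by exact_mod_cast hN
  obtain ⟨τ, hτ, hin⟩ := exists_inner_le hV (closure_subset_of_le_geoDist hV hV₁V hδ hdist)
  obtain ⟨C, hC⟩ := hY.exists_cesaroMaximal_le (l := ((N : ℝ) - 1) / 2) (by linarith) (by ring) hτ
  obtain ⟨K, hK, hKy⟩ := exists_lintegral_sphWeight_le hN
  refine ⟨C * K.toNNReal, fun f hf hfV μ hμ => ?_⟩
  have hq : ((N : ℝ) + 1) / 2 = ((N : ℝ) - 1) / 2 + 1 := by ring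
  rw [hq] at hKy
  rw [ENNReal.le_div_iff_mul_le (Or.inl (ENNReal.ofReal_pos.2 hμ).ne')
    (Or.inl ENNReal.ofReal_ne_top), ENNReal.coe_mul, ENNReal.coe_toNNReal hK, mul_comm]
  refine le_trans (mul_le_mul' le_rfl (measure_mono ?_))
    (mul_sphMeasure_lt_le hKy C hf (ENNReal.ofReal μ))
  rintro x ⟨hx, hxμ⟩
  exact hxμ.le.trans (hC f hf x fun y hy => hin x hx y fun hyV => hy (hfV y hyV))
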